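/- arXiv:2002.09314 — 5 statements merged into one kernel-verified Lean document; each statement's English description precedes it below -/
import Mathlib

section
/- Let 0 < α < 1, 0 < β < 1 with 1 < α + β < 2, and let −∞ < a < b < +∞. Let f be continuously differentiable on [a,b] and suppose the sequential Caputo derivative 𝒟^α_{a+}𝒟^β_{a+} f exists on (a,b) and extends continuously to [a,b]. If f attains its minimum over [a,b] at a point x* ∈ (a,b), then (𝒟^α_{a+}𝒟^β_{a+} f)(x*) ≥ ((α+β−1)/Γ(2−α−β)) · (x*−a)^{−α−β} · (f(a) − f(x*)) ≥ 0. -/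
open Set

/-- The Caputo fractional derivative of order `γ` with base point `a`:
`(𝒟^γ_{a+} f)(t) = (1/Γ(1−γ)) ∫_a^t (t−s)^{−γ} f′(s) ds`. -/
noncomputable def caputo (γ a : ℝ) (f : ℝ → ℝ) (t : ℝ) : ℝ :=
  (1 / Real.Gamma (1 - γ)) * ∫ s in a..t, (t - s) ^ (-γ) * deriv f s

/-- The fractional integral appearing in the sequential Caputo derivative:
`t ↦ (1/Γ(1−α)) ∫_a^t (t−s)^{−α} (𝒟^β_{a+} f)(s) ds`. -/
noncomputable def seqCaputoAux (α β a : ℝ) (f : ℝ → ℝ) (t : ℝ) : ℝ :=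
  (1 / Real.Gamma (1 - α)) * ∫ s in a..t, (t - s) ^ (-α) * caputo β a f s

/-- The sequential Caputo derivative
`(𝒟^α_{a+}𝒟^β_{a+} f)(t) = (d/dt)[(1/Γ(1−α)) ∫_a^t (t−s)^{−α} (𝒟^β_{a+} f)(s) ds]`. -/
noncomputable def seqCaputo (α β a : ℝ) (f : ℝ → ℝ) : ℝ → ℝ :=
  deriv (seqCaputoAux α β a f)


open MeasureTheory intervalIntegral in
lemma beta_real {p q : ℝ} (hp : 0 < p) (hq : 0 < q) {r t : ℝ} (hrt : r < t) :
    ∫ s in r..t, (t - s) ^ (p - 1) * (s - r) ^ (q - 1)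
      = ProbabilityTheory.beta p q * (t - r) ^ (p + q - 1) := by
  have hc : 0 < t - r := sub_pos.2 hrt
  have h1 : ∫ s in r..t, (t - s) ^ (p - 1) * (s - r) ^ (q - 1)
      = ∫ x in (0:ℝ)..(t - r), x ^ (p - 1) * ((t - r) - x) ^ (q - 1) := by
    have := intervalIntegral.integral_comp_sub_left (a := r) (b := t)
      (fun x : ℝ => x ^ (p - 1) * ((t - r) - x) ^ (q - 1)) t
    simp only [sub_self] at this
    rw [← this]
    congr 1
    ext s
    congr 2
    ring
  rw [h1]
  have h2 := Complex.betaIntegral_scaled (p : ℂ) (q : ℂ) hc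
  have h3 : ((∫ x in (0:ℝ)..(t - r), x ^ (p - 1) * ((t - r) - x) ^ (q - 1) : ℝ) : ℂ)
      = ∫ x in (0:ℝ)..(t - r), (x : ℂ) ^ ((p : ℂ) - 1) * (((t - r : ℝ) : ℂ) - x) ^ ((q:ℂ) - 1) := by
    rw [← intervalIntegral.integral_ofReal]
    apply intervalIntegral.integral_congr
    intro x hx
    rw [uIcc_of_le hc.le] at hx
    simp only
    rw [Complex.ofReal_mul, Complex.ofReal_cpow hx.1, Complex.ofReal_cpow (sub_nonneg.2 hx.2)]
    push_cast
    rfl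
  rw [h2] at h3
  have h4 := congrArg Complex.re h3
  rw [Complex.ofReal_re] at h4
  rw [h4, ProbabilityTheory.beta_eq_betaIntegralReal p q hp hq, mul_comm]
  have : ((t - r : ℝ) : ℂ) ^ ((p : ℂ) + q - 1) = (((t - r) ^ (p + q - 1) : ℝ) : ℂ) := by
    rw [Complex.ofReal_cpow hc.le]; push_cast; rfl
  rw [this, Complex.re_mul_ofReal]

open MeasureTheory intervalIntegral in
lemma beta_real_integrable {p q : ℝ} (hp : 0 < p) (hq : 0 < q) {r t : ℝ} (hrt : r < t) :
    IntervalIntegrable (fun s => (t - s) ^ (p - 1) * (s - r) ^ (q - 1)) volume r t := by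
  by_contra h
  have h1 := intervalIntegral.integral_undef h
  rw [beta_real hp hq hrt] at h1
  have := mul_pos (ProbabilityTheory.beta_pos hp hq) (Real.rpow_pos_of_pos (sub_pos.2 hrt) (p + q - 1))
  linarith

open MeasureTheory in
lemma ker_integrable {p : ℝ} (hp : 0 < p) {a c t : ℝ}
    {u : ℝ → ℝ} (hu : ContinuousOn u (uIcc a c)) :
    IntervalIntegrable (fun s => (t - s) ^ (p - 1) * u s) volume a c := by
  apply IntervalIntegrable.mul_continuousOn _ hu
  have := (intervalIntegral.intervalIntegrable_rpow' (r := p - 1) (a := t - a) (b := t - c)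
    (by linarith)).comp_sub_left t
  simpa using this

open MeasureTheory in
lemma semigroup_aux {p q : ℝ} (hp : 0 < p) (hq : 0 < q) {a t : ℝ} (hat : a ≤ t)
    {u : ℝ → ℝ} (hu : ContinuousOn u (Icc a t)) :
    IntervalIntegrable (fun s => (t - s) ^ (p - 1) * ∫ r in a..s, (s - r) ^ (q - 1) * u r)
      volume a t ∧
    ∫ s in a..t, (t - s) ^ (p - 1) * ∫ r in a..s, (s - r) ^ (q - 1) * u r
      = ProbabilityTheory.beta p q * ∫ r in a..t, (t - r) ^ (p + q - 1) * u r := by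
  set μ : Measure ℝ := volume.restrict (Ioc a t) with hμ
  let k : ℝ → ℝ → ℝ := fun s r => (t - s) ^ (p - 1) * (s - r) ^ (q - 1)
  let K : ℝ × ℝ → ℝ := fun z => if z.2 < z.1 then k z.1 z.2 else 0
  let F : ℝ × ℝ → ℝ := fun z => K z * u z.2
  have hKm : Measurable K := by
    apply Measurable.ite (measurableSet_lt measurable_snd measurable_fst) _ measurable_const
    simp only [k]
    fun_prop
  have hum : AEStronglyMeasurable u μ :=
    (hu.mono Ioc_subset_Icc_self).aestronglyMeasurable measurableSet_Ioc
  have hFm : AEStronglyMeasurable F (μ.prod μ) :=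
    hKm.aestronglyMeasurable.mul hum.comp_snd
  have hKind : ∀ r, (fun s => K (s, r)) = (Ioi r).indicator (fun s => k s r) := by
    intro r; ext s
    simp only [K, indicator, mem_Ioi]
  have hint : ∀ r, a < r → Ioc a t ∩ Ioi r = Ioc r t := by
    intro r har
    ext s
    simp only [mem_inter_iff, mem_Ioc, mem_Ioi]
    constructor
    · rintro ⟨⟨_, h⟩, h'⟩; exact ⟨h', h⟩
    · rintro ⟨h, h'⟩; exact ⟨⟨har.trans h, h'⟩, h⟩
  have hKi : ∀ r ∈ Ioo a t, Integrable (fun s => K (s, r)) μ := by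
    intro r hr
    rw [hKind r, integrable_indicator_iff measurableSet_Ioi, IntegrableOn, hμ,
      Measure.restrict_restrict measurableSet_Ioi, inter_comm, hint r hr.1]
    exact (intervalIntegrable_iff_integrableOn_Ioc_of_le hr.2.le).1
      (beta_real_integrable hp hq hr.2)
  have hKv : ∀ r ∈ Ioo a t, ∫ s, K (s, r) ∂μ
      = ProbabilityTheory.beta p q * (t - r) ^ (p + q - 1) := by
    intro r hr
    rw [hKind r, hμ, setIntegral_indicator measurableSet_Ioi, hint r hr.1,
      ← intervalIntegral.integral_of_le hr.2.le, beta_real hp hq hr.2]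
  have hKnn : ∀ r, ∀ s ∈ Ioc a t, 0 ≤ K (s, r) := by
    intro r s hs
    simp only [K]
    split_ifs with h
    · exact mul_nonneg (Real.rpow_nonneg (sub_nonneg.2 hs.2) _)
        (Real.rpow_nonneg (sub_nonneg.2 h.le) _)
    · exact le_rfl
  have hae : ∀ᵐ r ∂μ, r ∈ Ioo a t := by
    have : μ = volume.restrict (Ioo a t) := (restrict_Ioo_eq_restrict_Ioc).symm
    rw [this]
    exact ae_restrict_mem measurableSet_Ioo
  have hker : Integrable (fun r => (t - r) ^ (p + q - 1) * |u r|) μ := by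
    have := ker_integrable (p := p + q) (by linarith) (a := a) (c := t) (t := t) (u := fun r => |u r|)
      (by rw [uIcc_of_le hat]; exact hu.abs)
    exact (intervalIntegrable_iff_integrableOn_Ioc_of_le hat).1 this
  have hF : Integrable F (μ.prod μ) := by
    rw [integrable_prod_iff' hFm]
    constructor
    · filter_upwards [hae] with r hr
      exact (hKi r hr).mul_const (u r)
    · apply (hker.const_mul (ProbabilityTheory.beta p q)).congr
      filter_upwards [hae] with r hr
      have : ∫ s, ‖F (s, r)‖ ∂μ = ∫ s, K (s, r) * |u r| ∂μ := by
        apply integral_congr_ae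
        filter_upwards [ae_restrict_mem measurableSet_Ioc] with s hs
        simp only [F, norm_mul, Real.norm_eq_abs, abs_of_nonneg (hKnn r s hs)]
      rw [this, integral_mul_const, hKv r hr]
      ring
  have hin : ∀ s ∈ Ioc a t, ∫ r, F (s, r) ∂μ
      = (t - s) ^ (p - 1) * ∫ r in a..s, (s - r) ^ (q - 1) * u r := by
    intro s hs
    have h1 : (fun r => F (s, r)) = (Iio s).indicator
        (fun r => (t - s) ^ (p - 1) * ((s - r) ^ (q - 1) * u r)) := by
      ext r
      simp only [F, K, k, indicator, mem_Iio]
      split_ifs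
      · ring
      · ring
    have h2 : Ioc a t ∩ Iio s = Ioo a s := by
      ext r
      simp only [mem_inter_iff, mem_Ioc, mem_Iio, mem_Ioo]
      constructor
      · rintro ⟨⟨h, _⟩, h'⟩; exact ⟨h, h'⟩
      · rintro ⟨h, h'⟩; exact ⟨⟨h, h'.le.trans hs.2⟩, h'⟩
    rw [h1, hμ, setIntegral_indicator measurableSet_Iio, h2, ← integral_Ioc_eq_integral_Ioo,
      ← intervalIntegral.integral_of_le hs.1.le, intervalIntegral.integral_const_mul]
  constructor
  · rw [intervalIntegrable_iff_integrableOn_Ioc_of_le hat]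
    apply hF.integral_prod_left.congr
    filter_upwards [ae_restrict_mem measurableSet_Ioc] with s hs
    exact hin s hs
  · rw [intervalIntegral.integral_of_le hat, intervalIntegral.integral_of_le hat,
      ← setIntegral_congr_fun measurableSet_Ioc hin,
      integral_integral_swap (f := fun s r => F (s, r)) hF, ← integral_const_mul]
    apply integral_congr_ae
    filter_upwards [hae] with r hr
    simp only [F]
    rw [integral_mul_const, hKv r hr]
    ring

open MeasureTheory Filter Topology in
lemma first_part {δ η a x : ℝ} (hδ0 : 0 < δ) (hδ1 : δ < 1) (hη : 0 < η) (hax : a < x)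
    {h u : ℝ → ℝ} (hd : ∀ s ∈ Icc a x, HasDerivAt h (u s) s) (hu : ContinuousOn u (Icc a x))
    (hnn : ∀ s ∈ Icc a x, 0 ≤ h s) (hx : h x = 0) :
    -(((x + η - a) ^ (-δ) - (x - a) ^ (-δ)) * h a) ≤
      ∫ s in a..x, ((x + η - s) ^ (-δ) - (x - s) ^ (-δ)) * u s := by
  set k : ℝ → ℝ := fun s => (x + η - s) ^ (-δ) - (x - s) ^ (-δ) with hk
  have hki : IntervalIntegrable (fun s => k s * u s) volume a x := by
    have h1 := ker_integrable (p := 1 - δ) (by linarith) (a := a) (c := x) (t := x + η) (u := u)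
      (by rwa [uIcc_of_le hax.le])
    have h2 := ker_integrable (p := 1 - δ) (by linarith) (a := a) (c := x) (t := x) (u := u)
      (by rwa [uIcc_of_le hax.le])
    have h3 := h1.sub h2
    have e : 1 - δ - 1 = -δ := by ring
    rw [e] at h3
    convert! h3 using 1
    ext s
    simp only [hk]
    ring
  have hkd : ∀ s < x, HasDerivAt k
      (δ * (x + η - s) ^ (-δ - 1) - δ * (x - s) ^ (-δ - 1)) s := by
    intro s hs
    have h1 : HasDerivAt (fun s => (x + η - s) ^ (-δ)) _ s :=
      ((hasDerivAt_id s).const_sub (x + η)).rpow_const (p := -δ)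
        (Or.inl (by simp only [id]; linarith))
    have h2 : HasDerivAt (fun s => (x - s) ^ (-δ)) _ s :=
      ((hasDerivAt_id s).const_sub x).rpow_const (p := -δ)
        (Or.inl (by simp only [id]; linarith))
    convert! h1.sub h2 using 1
    simp only [id]
    ring
  have hkd' : ∀ s < x, δ * (x + η - s) ^ (-δ - 1) - δ * (x - s) ^ (-δ - 1) ≤ 0 := by
    intro s hs
    have := Real.rpow_le_rpow_of_nonpos (z := -δ - 1) (sub_pos.2 hs)
      (by linarith : x - s ≤ x + η - s) (by linarith)
    nlinarith
  have hcx : ContinuousWithinAt (fun s => k s * h s) (Icc a x) x := by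
    have hb : ContinuousWithinAt (fun s => (x + η - s) ^ (-δ) * h s) (Icc a x) x := by
      apply ContinuousAt.continuousWithinAt
      apply ContinuousAt.mul _ (hd x ⟨hax.le, le_rfl⟩).continuousAt
      apply ContinuousAt.rpow_const (by fun_prop)
      left; linarith
    have hc : ContinuousWithinAt (fun s => (x - s) ^ (-δ) * h s) (Icc a x) x := by
      rw [← continuousWithinAt_sdiff_self]
      unfold ContinuousWithinAt
      simp only [hx, mul_zero]
      have hsl := (hasDerivAt_iff_tendsto_slope.1 (hd x ⟨hax.le, le_rfl⟩)).mono_left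
        (nhdsWithin_mono x (fun s hs => hs.2 : Icc a x \ {x} ⊆ {x}ᶜ))
      have hpw : Tendsto (fun s => -(x - s) ^ (1 - δ)) (𝓝[Icc a x \ {x}] x) (𝓝 0) := by
        have : ContinuousAt (fun s => -(x - s) ^ (1 - δ)) x := by
          apply ContinuousAt.neg
          apply ContinuousAt.rpow_const (by fun_prop)
          right; linarith
        have := this.tendsto.mono_left (nhdsWithin_le_nhds (s := Icc a x \ {x}))
        simpa [Real.zero_rpow (by linarith : (1 - δ) ≠ 0)] using this
      have := hpw.mul hsl
      rw [zero_mul] at this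
      apply this.congr'
      filter_upwards [self_mem_nhdsWithin] with s hs
      have hsx : s < x := lt_of_le_of_ne hs.1.2 hs.2
      rw [slope_def_field, hx, sub_zero]
      have hne : s - x ≠ 0 := by linarith
      have e : (x - s) ^ (1 - δ) = (x - s) * (x - s) ^ (-δ) := by
        rw [sub_eq_add_neg 1 δ, Real.rpow_add (by linarith), Real.rpow_one]
      rw [e]
      field_simp
      ring
    convert! hb.sub hc using 1
    ext s
    simp only [hk, Pi.sub_apply]
    ring
  let Φ : ℝ → ℝ := fun y => (∫ s in a..y, k s * u s) - k y * h y
  have hΦd : ∀ y ∈ Ioo a x, HasDerivAt Φ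
      (-((δ * (x + η - y) ^ (-δ - 1) - δ * (x - y) ^ (-δ - 1)) * h y)) y := by
    intro y hy
    have hkuc : ContinuousOn (fun s => k s * u s) (Ioo a x) := by
      intro s hs
      exact (hkd s hs.2).continuousAt.continuousWithinAt.mul
        ((hu s ⟨hs.1.le, hs.2.le⟩).mono Ioo_subset_Icc_self)
    have h1 := intervalIntegral.integral_hasDerivAt_right (f := fun s => k s * u s) (a := a) (b := y)
      (hki.mono_set (by
        rw [uIcc_of_le hy.1.le, uIcc_of_le hax.le]; exact Icc_subset_Icc_right hy.2.le))
      (hkuc.stronglyMeasurableAtFilter isOpen_Ioo y hy)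
      (hkuc.continuousAt (isOpen_Ioo.mem_nhds hy))
    have h2 := (hkd y hy.2).mul (hd y ⟨hy.1.le, hy.2.le⟩)
    convert! h1.sub h2 using 1
    ring
  have hΦc : ContinuousOn Φ (Icc a x) := by
    apply ContinuousOn.sub
    · have := intervalIntegral.continuousOn_primitive_interval' hki (left_mem_uIcc)
      rwa [uIcc_of_le hax.le] at this
    · intro y hy
      rcases hy.2.lt_or_eq with hlt | heq
      · exact ((hkd y hlt).continuousAt.mul (hd y hy).continuousAt).continuousWithinAt
      · rw [heq]; exact hcx
  have hmono : MonotoneOn Φ (Icc a x) := by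
    apply monotoneOn_of_deriv_nonneg (convex_Icc a x) hΦc
    · rw [interior_Icc]
      exact fun y hy => (hΦd y hy).differentiableAt.differentiableWithinAt
    · rw [interior_Icc]
      intro y hy
      rw [(hΦd y hy).deriv]
      have h1 := hkd' y hy.2
      have h2 := hnn y ⟨hy.1.le, hy.2.le⟩
      nlinarith
  have hfin := hmono ⟨le_rfl, hax.le⟩ ⟨hax.le, le_rfl⟩ hax.le
  simpa [Φ, hx] using hfin

lemma seqCaputoAux_eq {α β a b : ℝ} {f : ℝ → ℝ}
    (hα1 : α < 1) (hβ1 : β < 1)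
    (hf' : ContinuousOn (deriv f) (Set.Icc a b)) {t : ℝ} (ht : t ∈ Icc a b) :
    Real.Gamma (2 - α - β) * seqCaputoAux α β a f t
      = ∫ s in a..t, (t - s) ^ (-(α + β - 1)) * deriv f s := by
  have hp : 0 < 1 - α := by linarith
  have hq : 0 < 1 - β := by linarith
  have h := (semigroup_aux hp hq ht.1 (hf'.mono (Icc_subset_Icc_right ht.2))).2
  have e1 : 1 - α - 1 = -α := by ring
  have e2 : 1 - β - 1 = -β := by ring
  have e3 : 1 - α + (1 - β) - 1 = -(α + β - 1) := by ring
  have e4 : 1 - α + (1 - β) = 2 - α - β := by ring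
  rw [e1, e2, e3] at h
  unfold seqCaputoAux caputo
  have : (∫ s in a..t, (t - s) ^ (-α) * (1 / Real.Gamma (1 - β) *
      ∫ r in a..s, (s - r) ^ (-β) * deriv f r))
      = 1 / Real.Gamma (1 - β) * ∫ s in a..t, (t - s) ^ (-α) *
        ∫ r in a..s, (s - r) ^ (-β) * deriv f r := by
    rw [← intervalIntegral.integral_const_mul]
    congr 1
    ext s
    ring
  rw [this, h, ProbabilityTheory.beta, e4]
  have g1 := (Real.Gamma_pos_of_pos hp).ne'
  have g2 := (Real.Gamma_pos_of_pos hq).ne'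
  have g3 := (Real.Gamma_pos_of_pos (by linarith : 0 < 2 - α - β)).ne'
  field_simp


open scoped Topology

/-- extremum estimate for the sequential Caputo derivative at an
interior minimum point, in the case `1 < α + β < 2`. -/
theorem seqCaputo_min_estimate_of_one_lt
    (α β a b : ℝ) (f : ℝ → ℝ) (xs : ℝ)
    (hα0 : 0 < α) (hα1 : α < 1) (hβ0 : 0 < β) (hβ1 : β < 1)
    (hsum1 : 1 < α + β) (hsum2 : α + β < 2) (hab : a < b)
    -- `f` is continuously differentiable on `[a,b]`
    (hf : ∀ x ∈ Set.Icc a b, HasDerivAt f (deriv f x) x)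
    (hf' : ContinuousOn (deriv f) (Set.Icc a b))
    -- the sequential Caputo derivative exists on `(a,b)`
    (hex : ∀ x ∈ Set.Ioo a b,
      HasDerivAt (seqCaputoAux α β a f) (seqCaputo α β a f x) x)
    -- and extends continuously to `[a,b]`
    (hcont : ∃ g : ℝ → ℝ, ContinuousOn g (Set.Icc a b) ∧
      ∀ x ∈ Set.Ioo a b, g x = seqCaputo α β a f x)
    -- `f` attains its minimum over `[a,b]` at `xs ∈ (a,b)`
    (hxs : xs ∈ Set.Ioo a b)
    (hmin : ∀ x ∈ Set.Icc a b, f xs ≤ f x) :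
    (α + β - 1) / Real.Gamma (2 - α - β) * (xs - a) ^ (-(α + β)) * (f a - f xs)
        ≤ seqCaputo α β a f xs ∧
      0 ≤ (α + β - 1) / Real.Gamma (2 - α - β) * (xs - a) ^ (-(α + β)) * (f a - f xs) := by
  obtain ⟨hax, hxb⟩ := hxs
  have hG : 0 < Real.Gamma (2 - α - β) := Real.Gamma_pos_of_pos (by linarith)
  have hfa : 0 ≤ f a - f xs := sub_nonneg.2 (hmin a ⟨le_rfl, hab.le⟩)
  have hxa : 0 < xs - a := sub_pos.2 hax
  refine ⟨?_, mul_nonneg (mul_nonneg (div_nonneg (by linarith) hG.le)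
    (Real.rpow_nonneg hxa.le _)) hfa⟩
  set δ := α + β - 1 with hδ
  have hδ0 : 0 < δ := by linarith
  have hδ1 : δ < 1 := by linarith
  set G := Real.Gamma (2 - α - β)
  set u := deriv f
  set D := seqCaputo α β a f xs
  let J : ℝ → ℝ := fun t => ∫ s in a..t, (t - s) ^ (-δ) * u s
  have hJ : HasDerivAt J (G * D) xs := by
    apply ((hex xs ⟨hax, hxb⟩).const_mul G).congr_of_eventuallyEq
    filter_upwards [Ioo_mem_nhds hax hxb] with t ht
    exact (seqCaputoAux_eq hα1 hβ1 hf' ⟨ht.1.le, ht.2.le⟩).symm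
  let W : ℝ → ℝ := fun t => J t + (t - a) ^ (-δ) * (f a - f xs)
  have hW : HasDerivAt W (G * D - δ * (xs - a) ^ (-(α + β)) * (f a - f xs)) xs := by
    have h1 : HasDerivAt (fun t => (t - a) ^ (-δ)) _ xs :=
      ((hasDerivAt_id xs).sub_const a).rpow_const (p := -δ) (Or.inl hxa.ne')
    convert! hJ.add (h1.mul_const (f a - f xs)) using 1
    have : -δ - 1 = -(α + β) := by rw [hδ]; ring
    rw [this]
    simp only [id]
    ring
  by_contra hlt
  push Not at hlt
  have hneg : G * D - δ * (xs - a) ^ (-(α + β)) * (f a - f xs) < 0 := by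
    have := mul_lt_mul_of_pos_left hlt hG
    have e : G * (δ / G * (xs - a) ^ (-(α + β)) * (f a - f xs))
        = δ * (xs - a) ^ (-(α + β)) * (f a - f xs) := by
      field_simp
    linarith
  have hR : ∀ t ∈ Ioo xs b, ∫ s in xs..t, (t - s) ^ (-δ) * u s ≤ W t - W xs := by
    intro t ht
    have h1 := first_part (h := fun s => f s - f xs) (u := u) hδ0 hδ1 (sub_pos.2 ht.1) hax
      (fun s hs => (hf s ⟨hs.1, hs.2.trans hxb.le⟩).sub_const _)
      (hf'.mono (Icc_subset_Icc_right hxb.le))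
      (fun s hs => sub_nonneg.2 (hmin s ⟨hs.1, hs.2.trans hxb.le⟩)) (sub_self _)
    rw [add_sub_cancel] at h1
    have e : 1 - δ - 1 = -δ := by ring
    have i1 := ker_integrable (p := 1 - δ) (by linarith) (a := a) (c := xs) (t := t) (u := u)
      (hf'.mono (by rw [uIcc_of_le hax.le]; exact Icc_subset_Icc_right hxb.le))
    have i2 := ker_integrable (p := 1 - δ) (by linarith) (a := xs) (c := t) (t := t) (u := u)
      (hf'.mono (by rw [uIcc_of_le ht.1.le]; exact Icc_subset_Icc hax.le ht.2.le))
    have i3 := ker_integrable (p := 1 - δ) (by linarith) (a := a) (c := xs) (t := xs) (u := u)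
      (hf'.mono (by rw [uIcc_of_le hax.le]; exact Icc_subset_Icc_right hxb.le))
    rw [e] at i1 i2 i3
    have h2 := intervalIntegral.integral_add_adjacent_intervals i1 i2
    have h3 := intervalIntegral.integral_sub i1 i3
    simp only [← sub_mul] at h3
    rw [h3] at h1
    simp only [W, J]
    rw [← h2]
    linarith
  have hev : ∀ᶠ t in 𝓝[>] xs, W t - W xs < 0 := by
    have h1 := (hasDerivAt_iff_tendsto_slope.1 hW).mono_left
        (nhdsWithin_mono xs (fun s hs => ne_of_gt hs : Ioi xs ⊆ {xs}ᶜ))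
    filter_upwards [h1.eventually_lt_const hneg, self_mem_nhdsWithin] with t ht htx
    rw [slope_def_field, div_neg_iff] at ht
    have : xs < t := htx
    rcases ht with ht | ht
    · linarith
    · exact ht.1
  obtain ⟨c, hc, hcs⟩ := mem_nhdsGT_iff_exists_Ioo_subset.1
    (Filter.inter_mem hev (Ioo_mem_nhdsGT hxb))
  have hc : xs < c := hc
  set d := (xs + c) / 2
  have hxd : xs < d := by simp only [d]; linarith
  have hdc : d < c := by simp only [d]; linarith
  have hdb : d < b := (hcs ⟨hxd, hdc⟩).2.2
  obtain ⟨hi, hv⟩ := semigroup_aux hδ0 (by linarith : 0 < 1 - δ) hxd.le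
    (hf'.mono (Icc_subset_Icc hax.le hdb.le))
  have e0 : δ + (1 - δ) - 1 = 0 := by ring
  have e : 1 - δ - 1 = -δ := by ring
  rw [e] at hi hv
  rw [e0] at hv
  simp only [Real.rpow_zero, one_mul] at hv
  have hftc : ∫ r in xs..d, u r = f d - f xs := by
    apply intervalIntegral.integral_eq_sub_of_hasDerivAt
    · intro s hs
      rw [uIcc_of_le hxd.le] at hs
      exact hf s ⟨hax.le.trans hs.1, hs.2.trans hdb.le⟩
    · apply ContinuousOn.intervalIntegrable
      rw [uIcc_of_le hxd.le]
      exact hf'.mono (Icc_subset_Icc hax.le hdb.le)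
  have hpos := intervalIntegral.intervalIntegral_pos_of_pos_on hi.neg (by
    intro s hs
    have hm := hcs ⟨hs.1, hs.2.trans hdc⟩
    have h1 : W s - W xs < 0 := hm.1
    have h2 := hR s hm.2
    have h3 : 0 < (d - s) ^ (δ - 1) := Real.rpow_pos_of_pos (sub_pos.2 hs.2) _
    simp only [Pi.neg_apply]
    nlinarith) hxd
  simp only [Pi.neg_apply, intervalIntegral.integral_neg] at hpos
  rw [hv, hftc] at hpos
  have := mul_nonneg (ProbabilityTheory.beta_pos hδ0 (by linarith : 0 < 1 - δ)).le
    (sub_nonneg.2 (hmin d ⟨hax.le.trans hxd.le, hdb.le⟩))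
  linarith
end

section
/- Let 0 < α < 1, 0 < β < 1 with 1 < α + β < 2, and let −∞ < a < b < +∞. Let f be continuously differentiable on [a,b] and suppose the sequential Caputo derivative 𝒟^α_{a+}𝒟^β_{a+} f exists on (a,b) and extends continuously to [a,b]. If f attains its maximum over [a,b] at a point x* ∈ (a,b), then (𝒟^α_{a+}𝒟^β_{a+} f)(x*) ≤ ((α+β−1)/Γ(2−α−β)) · (x*−a)^{−α−β} · (f(a) − f(x*)) ≤ 0. -/
open Set

open MeasureTheory Filter Topology

lemma aux_beta (p q L : ℝ) (hp : 0 < p) (hq : 0 < q) (hL : 0 < L) :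
    (∫ x in (0:ℝ)..L, x ^ (p - 1) * (L - x) ^ (q - 1)) =
      L ^ (p + q - 1) * (Real.Gamma p * Real.Gamma q / Real.Gamma (p + q)) := by
  have h1 := Complex.betaIntegral_scaled (p : ℂ) (q : ℂ) hL
  rw [Complex.betaIntegral_eq_Gamma_mul_div _ _ (by simpa) (by simpa)] at h1
  have h2 : (∫ x in (0:ℝ)..L, (x : ℂ) ^ ((p:ℂ) - 1) * ((L : ℂ) - x) ^ ((q:ℂ) - 1)) =
      ∫ x in (0:ℝ)..L, ((x ^ (p - 1) * (L - x) ^ (q - 1) : ℝ) : ℂ) := by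
    apply intervalIntegral.integral_congr
    intro x hx
    rw [uIcc_of_le hL.le] at hx
    simp only
    rw [Complex.ofReal_mul, Complex.ofReal_cpow hx.1, Complex.ofReal_cpow (by linarith [hx.2])]
    push_cast
    rfl
  rw [h2, intervalIntegral.integral_ofReal, ← Complex.ofReal_add, Complex.Gamma_ofReal,
    Complex.Gamma_ofReal, Complex.Gamma_ofReal] at h1
  have h3 : ((L : ℂ) ^ (((p + q : ℝ) : ℂ) - 1)) = ((L ^ (p + q - 1) : ℝ) : ℂ) := by
    rw [Complex.ofReal_cpow hL.le]; push_cast; rfl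
  rw [h3] at h1
  exact_mod_cast h1

lemma aux_beta2 (p q r t : ℝ) (hp : 0 < p) (hq : 0 < q) (hL : r < t) :
    IntegrableOn (fun s => (t - s) ^ (p - 1) * (s - r) ^ (q - 1)) (Ioo r t) ∧
    (∫ s in Ioo r t, (t - s) ^ (p - 1) * (s - r) ^ (q - 1)) =
      (Real.Gamma p * Real.Gamma q / Real.Gamma (p + q)) * (t - r) ^ (p + q - 1) := by
  have h : (∫ s in Ioo r t, (t - s) ^ (p - 1) * (s - r) ^ (q - 1)) =
      (Real.Gamma p * Real.Gamma q / Real.Gamma (p + q)) * (t - r) ^ (p + q - 1) := by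
    rw [← integral_Ioc_eq_integral_Ioo, ← intervalIntegral.integral_of_le hL.le]
    have := intervalIntegral.integral_comp_sub_left
      (fun x => x ^ (p - 1) * ((t - r) - x) ^ (q - 1)) t (a := r) (b := t)
    rw [sub_self, aux_beta p q _ hp hq (sub_pos.2 hL)] at this
    rw [mul_comm, ← this]
    apply intervalIntegral.integral_congr
    intro x hx
    simp only
    congr 2
    ring
  refine ⟨?_, h⟩
  by_contra hc
  rw [IntegrableOn] at hc
  rw [integral_undef hc] at h
  have := Real.Gamma_pos_of_pos hp
  have := Real.Gamma_pos_of_pos hq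
  have := Real.Gamma_pos_of_pos (add_pos hp hq)
  have := Real.rpow_pos_of_pos (sub_pos.2 hL) (p + q - 1)
  have : 0 < (Real.Gamma p * Real.Gamma q / Real.Gamma (p + q)) * (t - r) ^ (p + q - 1) := by
    positivity
  linarith

lemma aux_int (p a t : ℝ) (hp : 0 < p) (φ : ℝ → ℝ) (hφ : Measurable φ) (M : ℝ)
    (hM : ∀ r ∈ Ioo a t, |φ r| ≤ M) :
    IntegrableOn (fun s => (t - s) ^ (p - 1) * φ s) (Ioo a t) := by
  have h : IntegrableOn (fun s => (t - s) ^ (p - 1)) (Ioo a t) := by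
    rcases le_or_gt t a with h | h
    · simp [Ioo_eq_empty_of_le h]
    have := aux_beta2 p 1 a t hp one_pos h
    simpa using this.1
  apply Integrable.mul_bdd (c := M) h hφ.aestronglyMeasurable
  exact (ae_restrict_iff' measurableSet_Ioo).2 (Eventually.of_forall hM)

/-- truncated power -/
noncomputable def tpow (p x : ℝ) : ℝ := if 0 < x then x ^ (p - 1) else 0

lemma tpow_meas (p : ℝ) : Measurable (tpow p) := by
  unfold tpow
  exact Measurable.ite measurableSet_Ioi (by fun_prop) measurable_const

lemma tpow_nonneg (p x : ℝ) : 0 ≤ tpow p x := by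
  unfold tpow
  split_ifs with h
  · exact Real.rpow_nonneg h.le _
  · exact le_rfl

lemma aux_fub (p q a t : ℝ) (hp : 0 < p) (hq : 0 < q) (hat : a ≤ t)
    (φ : ℝ → ℝ) (hφ : Measurable φ) (M : ℝ) (hM : ∀ r ∈ Ioo a t, |φ r| ≤ M) :
    IntervalIntegrable (fun s => (t - s) ^ (p - 1) * ∫ r in a..s, (s - r) ^ (q - 1) * φ r)
      volume a t ∧
    (∫ s in a..t, (t - s) ^ (p - 1) * ∫ r in a..s, (s - r) ^ (q - 1) * φ r) =
      Real.Gamma p * Real.Gamma q / Real.Gamma (p + q) *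
        ∫ r in a..t, (t - r) ^ (p + q - 1) * φ r := by
  set B := Real.Gamma p * Real.Gamma q / Real.Gamma (p + q) with hB
  set μ := (volume : Measure ℝ).restrict (Ioo a t) with hμ
  let K : ℝ → ℝ → ℝ := fun s r => tpow p (t - s) * (tpow q (s - r) * φ r)
  have hKm : Measurable (Function.uncurry K) := by
    have h1 := tpow_meas p
    have h2 := tpow_meas q
    unfold K Function.uncurry
    fun_prop
  -- inner integral over r
  have inner : ∀ s ∈ Ioo a t, ∫ r, K s r ∂μ =
      (t - s) ^ (p - 1) * ∫ r in a..s, (s - r) ^ (q - 1) * φ r := by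
    intro s hs
    rw [intervalIntegral.integral_of_le hs.1.le, integral_Ioc_eq_integral_Ioo,
      ← integral_const_mul]
    have hz : ∀ r ∈ Ioo a t \ Ioo a s, K s r = 0 := by
      rintro r ⟨hr, hr'⟩
      have : ¬ (0 < s - r) := fun h => hr' ⟨hr.1, by linarith⟩
      simp only [K, tpow, if_neg this, zero_mul, mul_zero]
    have he : EqOn (K s) (fun r => (t - s) ^ (p - 1) * ((s - r) ^ (q - 1) * φ r)) (Ioo a s) := by
      intro r hr
      have h1 : 0 < s - r := by linarith [hr.2]
      have h2 : 0 < t - s := by linarith [hs.2]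
      simp only [K, tpow, if_pos h1, if_pos h2]
    rw [← setIntegral_congr_fun measurableSet_Ioo he]
    exact setIntegral_eq_of_subset_of_forall_sdiff_eq_zero measurableSet_Ioo
      (Ioo_subset_Ioo_right hs.2.le) hz
  -- inner over s
  have innerI : ∀ r ∈ Ioo a t, Integrable (fun s => tpow p (t - s) * tpow q (s - r)) μ ∧
      ∫ s, tpow p (t - s) * tpow q (s - r) ∂μ = B * (t - r) ^ (p + q - 1) := by
    intro r hr
    obtain ⟨b1, b2⟩ := aux_beta2 p q r t hp hq hr.2
    have hz : ∀ s ∈ Ioo a t \ Ioo r t, tpow p (t - s) * tpow q (s - r) = 0 := by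
      rintro s ⟨hs, hs'⟩
      have : ¬ (0 < s - r) := fun h => hs' ⟨by linarith, hs.2⟩
      simp [tpow, this]
    have he : EqOn (fun s => tpow p (t - s) * tpow q (s - r))
        (fun s => (t - s) ^ (p - 1) * (s - r) ^ (q - 1)) (Ioo r t) := by
      intro s hs
      have h1 : 0 < s - r := by linarith [hs.1]
      have h2 : 0 < t - s := by linarith [hs.2]
      simp [tpow, h1, h2]
    constructor
    · exact IntegrableOn.of_forall_sdiff_eq_zero (b1.congr_fun he.symm measurableSet_Ioo)
        measurableSet_Ioo hz
    · rw [← b2, ← setIntegral_congr_fun measurableSet_Ioo he, hμ]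
      exact setIntegral_eq_of_subset_of_forall_sdiff_eq_zero measurableSet_Ioo
        (Ioo_subset_Ioo_left hr.1.le) hz
  have hKint : Integrable (Function.uncurry K) (μ.prod μ) := by
    rw [integrable_prod_iff' hKm.aestronglyMeasurable]
    constructor
    · refine (ae_restrict_iff' measurableSet_Ioo).2 (Eventually.of_forall fun r hr => ?_)
      have := (innerI r hr).1.mul_const (φ r)
      simpa [K, mul_assoc] using this
    · have h1 : IntegrableOn (fun r => B * ((t - r) ^ (p + q - 1) * |φ r|)) (Ioo a t) :=
        (aux_int (p + q) a t (add_pos hp hq) (fun r => |φ r|) (by fun_prop) M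
          (by simpa using hM)).const_mul B
      refine IntegrableOn.congr_fun h1 ?_ measurableSet_Ioo
      intro r hr
      simp only [Function.uncurry, K]
      rw [← mul_assoc, ← (innerI r hr).2, ← integral_mul_const]
      congr 1
      ext s
      rw [Real.norm_eq_abs, abs_mul, abs_mul, abs_of_nonneg (tpow_nonneg _ _),
        abs_of_nonneg (tpow_nonneg _ _), mul_assoc]
  refine ⟨?_, ?_⟩
  · rw [intervalIntegrable_iff_integrableOn_Ioo_of_le hat]
    exact IntegrableOn.congr_fun hKint.integral_prod_left inner measurableSet_Ioo
  have hsw := integral_integral_swap hKint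
  rw [intervalIntegral.integral_of_le hat, integral_Ioc_eq_integral_Ioo,
    ← setIntegral_congr_fun measurableSet_Ioo inner, ← hμ, hsw,
    intervalIntegral.integral_of_le hat, integral_Ioc_eq_integral_Ioo, ← integral_const_mul]
  apply setIntegral_congr_fun measurableSet_Ioo
  intro r hr
  simp only [K]
  rw [← mul_assoc, ← (innerI r hr).2, ← integral_mul_const]
  congr 1
  ext s
  ring

lemma aux_left (m a x t M : ℝ) (f : ℝ → ℝ) (hm0 : 0 < m) (hm1 : m < 1) (hax : a < x) (hxt : x < t)
    (hf : ∀ s ∈ Icc a x, HasDerivAt f (deriv f s) s)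
    (hM : ∀ s ∈ Icc a x, |deriv f s| ≤ M) (hmax : ∀ s ∈ Icc a x, f s ≤ f x)
    (hint : IntegrableOn (fun s => ((t - s) ^ (m - 1) - (x - s) ^ (m - 1)) * deriv f s) (Icc a x)) :
    (∫ s in a..x, ((t - s) ^ (m - 1) - (x - s) ^ (m - 1)) * deriv f s) ≤
      ((t - a) ^ (m - 1) - (x - a) ^ (m - 1)) * (f x - f a) := by
  let g : ℝ → ℝ := fun s => -(((t - s) ^ (m - 1) - (x - s) ^ (m - 1)) * (f x - f s))
  let g' : ℝ → ℝ := fun s => -((-1 * (m - 1) * (t - s) ^ (m - 1 - 1)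
    - -1 * (m - 1) * (x - s) ^ (m - 1 - 1)) * (f x - f s)
    + ((t - s) ^ (m - 1) - (x - s) ^ (m - 1)) * (- deriv f s))
  have hd : ∀ s ∈ Ico a x, HasDerivAt g (g' s) s := by
    intro s hs
    have h1 : HasDerivAt (fun s => (t - s) ^ (m - 1)) (-1 * (m - 1) * (t - s) ^ (m - 1 - 1)) s :=
      ((hasDerivAt_id s).const_sub t).rpow_const (Or.inl (by simp; linarith [hs.2]))
    have h2 : HasDerivAt (fun s => (x - s) ^ (m - 1)) (-1 * (m - 1) * (x - s) ^ (m - 1 - 1)) s :=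
      ((hasDerivAt_id s).const_sub x).rpow_const (Or.inl (by simp; linarith [hs.2]))
    exact ((h1.sub h2).mul ((hf s ⟨hs.1, hs.2.le⟩).const_sub (f x))).neg
  have hgx : g x = 0 := by simp [g]
  have hcx : ContinuousWithinAt g (Icc a x) x := by
    have hA : ContinuousWithinAt (fun s => (t - s) ^ (m - 1) * (f x - f s)) (Icc a x) x := by
      have h1 : ContinuousAt (fun s => (t - s) ^ (m - 1)) x :=
        ContinuousAt.rpow_const (by fun_prop) (Or.inl (by linarith))
      have h2 : ContinuousAt f x := (hf x ⟨hax.le, le_rfl⟩).continuousAt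
      exact (h1.mul (continuousAt_const.sub h2)).continuousWithinAt
    have hB : ContinuousWithinAt (fun s => (x - s) ^ (m - 1) * (f x - f s)) (Icc a x) x := by
      rw [ContinuousWithinAt]
      simp only [sub_self, mul_zero]
      have hlim : Tendsto (fun s => M * (x - s) ^ m) (𝓝[Icc a x] x) (𝓝 0) := by
        have : ContinuousAt (fun s => M * (x - s) ^ m) x :=
          continuousAt_const.mul (ContinuousAt.rpow_const (by fun_prop) (Or.inr hm0.le))
        have h := this.continuousWithinAt (s := Icc a x)
        rw [ContinuousWithinAt] at h
        simpa [Real.zero_rpow hm0.ne'] using h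
      refine squeeze_zero_norm' ?_ hlim
      filter_upwards [self_mem_nhdsWithin] with s hs
      rcases hs.2.eq_or_lt with h | h
      · simp [h, Real.zero_rpow hm0.ne']
      · have hl : ‖f x - f s‖ ≤ M * ‖x - s‖ :=
          (convex_Icc a x).norm_image_sub_le_of_norm_hasDerivWithin_le
            (fun y hy => (hf y hy).hasDerivWithinAt) hM hs ⟨hax.le, le_rfl⟩
        have hp : 0 < x - s := sub_pos.2 h
        rw [norm_mul, Real.norm_of_nonneg (Real.rpow_nonneg hp.le _)]
        rw [Real.norm_of_nonneg hp.le] at hl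
        calc _ ≤ (x - s) ^ (m - 1) * (M * (x - s)) := by gcongr
          _ = M * (x - s) ^ m := by
            rw [Real.rpow_sub_one hp.ne']; field_simp
    have := (hA.sub hB).neg
    refine this.congr (fun s _ => ?_) ?_ <;> simp [g, sub_mul]
  have hc : ContinuousOn g (Icc a x) := by
    intro s hs
    rcases hs.2.eq_or_lt with h | h
    · rw [h]; exact hcx
    · exact (hd s ⟨hs.1, h⟩).continuousAt.continuousWithinAt
  have := intervalIntegral.integral_le_sub_of_hasDeriv_right_of_le hax.le hc
    (fun s hs => (hd s ⟨hs.1.le, hs.2⟩).hasDerivWithinAt) hint ?_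
  · rw [hgx] at this
    simpa [g] using this
  · intro s hs
    have h1 : (t - s) ^ (m - 1 - 1) ≤ (x - s) ^ (m - 1 - 1) :=
      Real.rpow_le_rpow_of_nonpos (by linarith [hs.2]) (by linarith) (by linarith)
    have h2 := hmax s ⟨hs.1.le, hs.2.le⟩
    have : 0 ≤ (1 - m) * ((x - s) ^ (m - 1 - 1) - (t - s) ^ (m - 1 - 1)) * (f x - f s) :=
      mul_nonneg (mul_nonneg (by linarith) (by linarith)) (by linarith)
    simp only [g']
    nlinarith

lemma aux_right (m x y M : ℝ) (f : ℝ → ℝ) (hm0 : 0 < m) (hm1 : m < 1) (hxy : x < y)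
    (hf : ∀ s ∈ Icc x y, HasDerivAt f (deriv f s) s) (hf' : ContinuousOn (deriv f) (Icc x y))
    (hM : ∀ s ∈ Icc x y, |deriv f s| ≤ M) (hmax : f y ≤ f x) :
    ∃ t ∈ Ioo x y, (∫ s in x..t, (t - s) ^ (m - 1) * deriv f s) ≤ 0 := by
  by_contra! hc
  obtain ⟨h1, h2⟩ := aux_fub (1 - m) m x y (by linarith) hm0 hxy.le (deriv f) (measurable_deriv f) M
    (fun r hr => hM r ⟨hr.1.le, hr.2.le⟩)
  have h3 : (∫ r in x..y, (y - r) ^ (1 - m + m - 1) * deriv f r) = f y - f x := by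
    have : ∀ r, (y - r) ^ (1 - m + m - 1) * deriv f r = deriv f r := by
      intro r
      rw [show 1 - m + m - 1 = 0 by ring, Real.rpow_zero, one_mul]
    simp_rw [this]
    apply intervalIntegral.integral_eq_sub_of_hasDerivAt
    · rw [uIcc_of_le hxy.le]; exact hf
    · apply ContinuousOn.intervalIntegrable
      rw [uIcc_of_le hxy.le]; exact hf'
  have h4 := intervalIntegral.intervalIntegral_pos_of_pos_on h1 (fun t ht =>
    mul_pos (Real.rpow_pos_of_pos (by linarith [ht.2]) _) (hc t ht)) hxy
  rw [h2, h3] at h4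
  have h5 : 0 < Real.Gamma (1 - m) := Real.Gamma_pos_of_pos (by linarith)
  have h6 : 0 < Real.Gamma m := Real.Gamma_pos_of_pos hm0
  have h7 : 0 < Real.Gamma (1 - m + m) := Real.Gamma_pos_of_pos (by linarith)
  have h8 : 0 < Real.Gamma (1 - m) * Real.Gamma m / Real.Gamma (1 - m + m) := by positivity
  have := (pos_iff_pos_of_mul_pos h4).1 h8
  linarith

lemma aux_repr (α β a t M : ℝ) (f : ℝ → ℝ) (hα1 : α < 1) (hβ1 : β < 1) (hat : a ≤ t)
    (hM : ∀ s ∈ Icc a t, |deriv f s| ≤ M) :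
    seqCaputoAux α β a f t =
      1 / Real.Gamma (2 - α - β) * ∫ s in a..t, (t - s) ^ (2 - α - β - 1) * deriv f s := by
  have h := (aux_fub (1 - α) (1 - β) a t (by linarith) (by linarith) hat (deriv f)
    (measurable_deriv f) M (fun r hr => hM r ⟨hr.1.le, hr.2.le⟩)).2
  have h5 : 0 < Real.Gamma (1 - α) := Real.Gamma_pos_of_pos (by linarith)
  have h6 : 0 < Real.Gamma (1 - β) := Real.Gamma_pos_of_pos (by linarith)
  have h7 : 0 < Real.Gamma (2 - α - β) := Real.Gamma_pos_of_pos (by linarith)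
  rw [show 1 - α + (1 - β) = 2 - α - β by ring, show 1 - α - 1 = -α by ring,
    show 1 - β - 1 = -β by ring] at h
  unfold seqCaputoAux caputo
  have e : ∀ s, (t - s) ^ (-α) * (1 / Real.Gamma (1 - β) * ∫ r in a..s, (s - r) ^ (-β) * deriv f r)
      = 1 / Real.Gamma (1 - β) * ((t - s) ^ (-α) * ∫ r in a..s, (s - r) ^ (-β) * deriv f r) := by
    intro s; ring
  simp_rw [e]
  rw [intervalIntegral.integral_const_mul, h]
  field_simp

lemma aux_deriv (Φ : ℝ → ℝ) (d x b : ℝ) (hd : HasDerivAt Φ d x) (hxb : x < b)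
    (h : ∀ y ∈ Ioo x b, ∃ t ∈ Ioo x y, Φ t ≤ Φ x) : d ≤ 0 := by
  by_contra! hc
  have h1 := hasDerivAt_iff_tendsto_slope.1 hd
  have h2 := (h1.mono_left (nhdsWithin_mono x (fun y (hy : y ∈ Ioi x) => (ne_of_gt hy)))).eventually
    (lt_mem_nhds hc)
  obtain ⟨u, hu, hu'⟩ := (mem_nhdsGT_iff_exists_Ioo_subset).1 h2
  have hu : x < u := hu
  obtain ⟨y, hy1, hy2⟩ := exists_between (lt_min hu hxb)
  obtain ⟨t, ht, htt⟩ := h y ⟨hy1, hy2.trans_le (min_le_right _ _)⟩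
  have := hu' ⟨ht.1, ht.2.trans (hy2.trans_le (min_le_left _ _))⟩
  simp only [mem_setOf_eq, slope_def_field] at this
  have h3 := (div_pos_iff_of_pos_right (sub_pos.2 ht.1)).1 this
  linarith
/-- extremum estimate for the sequential Caputo derivative at an
interior maximum point, in the case `1 < α + β < 2`. -/
theorem seqCaputo_max_estimate_of_one_lt
    (α β a b : ℝ) (f : ℝ → ℝ) (xs : ℝ)
    (hα0 : 0 < α) (hα1 : α < 1) (hβ0 : 0 < β) (hβ1 : β < 1)
    (hsum1 : 1 < α + β) (hsum2 : α + β < 2) (hab : a < b)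
    (hf : ∀ x ∈ Set.Icc a b, HasDerivAt f (deriv f x) x)
    (hf' : ContinuousOn (deriv f) (Set.Icc a b))
    (hex : ∀ x ∈ Set.Ioo a b,
      HasDerivAt (seqCaputoAux α β a f) (seqCaputo α β a f x) x)
    (hcont : ∃ g : ℝ → ℝ, ContinuousOn g (Set.Icc a b) ∧
      ∀ x ∈ Set.Ioo a b, g x = seqCaputo α β a f x)
    (hxs : xs ∈ Set.Ioo a b)
    (hmax : ∀ x ∈ Set.Icc a b, f x ≤ f xs) :
    seqCaputo α β a f xs
        ≤ (α + β - 1) / Real.Gamma (2 - α - β) * (xs - a) ^ (-(α + β)) * (f a - f xs) ∧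
      (α + β - 1) / Real.Gamma (2 - α - β) * (xs - a) ^ (-(α + β)) * (f a - f xs) ≤ 0 := by
  obtain ⟨hx1, hx2⟩ := hxs
  set m := 2 - α - β with hm
  have hm0 : 0 < m := by linarith
  have hm1 : m < 1 := by linarith
  have hΓ : 0 < Real.Gamma m := Real.Gamma_pos_of_pos hm0
  have hfa : f a ≤ f xs := hmax a ⟨le_rfl, hab.le⟩
  refine ⟨?_, ?_⟩
  swap
  · apply mul_nonpos_of_nonneg_of_nonpos
    · have := Real.rpow_nonneg (sub_nonneg.2 hx1.le) (-(α + β))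
      have : 0 ≤ α + β - 1 := by linarith
      positivity
    · linarith
  obtain ⟨M, hM⟩ := isCompact_Icc.exists_bound_of_continuousOn hf'
  have hM : ∀ s ∈ Icc a b, |deriv f s| ≤ M := hM
  have hrep : ∀ t ∈ Icc a b, seqCaputoAux α β a f t =
      1 / Real.Gamma m * ∫ s in a..t, (t - s) ^ (m - 1) * deriv f s := fun t ht =>
    aux_repr α β a t M f hα1 hβ1 ht.1 (fun s hs => hM s ⟨hs.1, hs.2.trans ht.2⟩)
  have hII : ∀ t ∈ Icc a b,
      IntervalIntegrable (fun s => (t - s) ^ (m - 1) * deriv f s) volume a t := by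
    intro t ht
    rw [intervalIntegrable_iff_integrableOn_Ioo_of_le ht.1]
    exact aux_int m a t hm0 (deriv f) (measurable_deriv f) M
      (fun r hr => hM r ⟨hr.1.le, hr.2.le.trans ht.2⟩)
  let Φ : ℝ → ℝ := fun t => seqCaputoAux α β a f t -
    1 / Real.Gamma m * (f xs - f a) * (t - a) ^ (m - 1)
  have hΦ : HasDerivAt Φ (seqCaputo α β a f xs -
      1 / Real.Gamma m * (f xs - f a) * (1 * (m - 1) * (xs - a) ^ (m - 1 - 1))) xs := by
    have h1 : HasDerivAt (fun t => (t - a) ^ (m - 1)) (1 * (m - 1) * (xs - a) ^ (m - 1 - 1)) xs :=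
      ((hasDerivAt_id xs).sub_const a).rpow_const (Or.inl (by simp; linarith))
    exact (hex xs ⟨hx1, hx2⟩).sub (h1.const_mul _)
  have key := aux_deriv Φ _ xs b hΦ hx2 ?_
  · have e : (α + β - 1) / Real.Gamma m * (xs - a) ^ (-(α + β)) * (f a - f xs) =
      1 / Real.Gamma m * (f xs - f a) * (1 * (m - 1) * (xs - a) ^ (m - 1 - 1)) := by
      rw [show m - 1 - 1 = -(α + β) by rw [hm]; ring, show m - 1 = -(α + β - 1) by rw [hm]; ring]
      ring
    rw [e]
    linarith
  · intro y hy
    obtain ⟨t, ht, hR⟩ := aux_right m xs y M f hm0 hm1 hy.1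
      (fun s hs => hf s ⟨hx1.le.trans hs.1, hs.2.trans hy.2.le⟩)
      (hf'.mono (Icc_subset_Icc hx1.le hy.2.le))
      (fun s hs => hM s ⟨hx1.le.trans hs.1, hs.2.trans hy.2.le⟩)
      (hmax y ⟨(hx1.trans hy.1).le, hy.2.le⟩)
    refine ⟨t, ht, ?_⟩
    have htb : t ∈ Icc a b := ⟨(hx1.trans ht.1).le, (ht.2.trans hy.2).le⟩
    have hxb : xs ∈ Icc a b := ⟨hx1.le, hx2.le⟩
    have i1 := hII t htb
    have i2 := hII xs hxb
    have hsub : uIcc a xs ⊆ uIcc a t := by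
      rw [uIcc_of_le hx1.le, uIcc_of_le htb.1]
      exact Icc_subset_Icc_right ht.1.le
    have hsub' : uIcc xs t ⊆ uIcc a t := by
      rw [uIcc_of_le ht.1.le, uIcc_of_le htb.1]
      exact Icc_subset_Icc_left hx1.le
    have i3 := i1.mono_set hsub
    have i4 := i1.mono_set hsub'
    have hsplit := intervalIntegral.integral_add_adjacent_intervals i3 i4
    have hdiff := intervalIntegral.integral_sub i3 i2
    simp_rw [← sub_mul] at hdiff
    have hint := i3.sub i2
    simp_rw [← sub_mul] at hint
    rw [intervalIntegrable_iff_integrableOn_Icc_of_le hx1.le] at hint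
    have hL := aux_left m a xs t M f hm0 hm1 hx1 ht.1
      (fun s hs => hf s ⟨hs.1, hs.2.trans hx2.le⟩) (fun s hs => hM s ⟨hs.1, hs.2.trans hx2.le⟩)
      (fun s hs => hmax s ⟨hs.1, hs.2.trans hx2.le⟩) hint
    simp only [Φ]
    rw [hrep t htb, hrep xs hxb, mul_assoc, mul_assoc, ← mul_sub, ← mul_sub]
    apply mul_le_mul_of_nonneg_left _ (by positivity)
    linarith
end

section
/- Let 0 < α < 1, 0 < β < 1 with α + β < 1, and let −∞ < a < b < +∞. Let f be continuously differentiable on [a,b] and suppose the sequential Caputo derivative 𝒟^α_{a+}𝒟^β_{a+} f exists on (a,b) and extends continuously to [a,b]. If f attains its maximum over [a,b] at a point x* ∈ (a,b), then (𝒟^α_{a+}𝒟^β_{a+} f)(x*) ≥ ((α+β−1)/Γ(2−α−β)) · (x*−a)^{−α−β} · (f(a) − f(x*)) ≥ 0. -/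
open Set

open MeasureTheory intervalIntegral in
lemma ker_int {c : ℝ} (hc : c < 1) (p q t : ℝ) :
    IntervalIntegrable (fun s => (t - s) ^ (-c)) volume p q := by
  have h := (intervalIntegrable_rpow' (a := t - p) (b := t - q) (r := -c) (by linarith)).comp_sub_left t
  simpa using h

open MeasureTheory intervalIntegral in
lemma ker_int2 {c : ℝ} (hc : c < 1) (p q t : ℝ) :
    IntervalIntegrable (fun s => (s - t) ^ (-c)) volume p q := by
  have h := (intervalIntegrable_rpow' (a := p - t) (b := q - t) (r := -c) (by linarith)).comp_sub_right t
  simpa using h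

open MeasureTheory intervalIntegral in
lemma ker_val {c : ℝ} (hc : c < 1) (p t : ℝ) :
    ∫ s in p..t, (t - s) ^ (-c) = (t - p) ^ (1 - c) / (1 - c) := by
  rw [intervalIntegral.integral_comp_sub_left (fun x => x ^ (-c)) t, integral_rpow (Or.inl (by linarith))]
  rw [sub_self, Real.zero_rpow (by linarith)]
  ring_nf

open MeasureTheory intervalIntegral in
lemma beta_val {α β : ℝ} (hα : α < 1) (hβ : β < 1) {p t : ℝ} (h : p < t) :
    ∫ s in p..t, (t - s) ^ (-α) * (s - p) ^ (-β)
      = Real.Gamma (1 - α) * Real.Gamma (1 - β) / Real.Gamma (2 - α - β)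
        * (t - p) ^ (1 - α - β) := by
  have h1 := Complex.betaIntegral_scaled ((1 - β : ℝ) : ℂ) ((1 - α : ℝ) : ℂ) (sub_pos.2 h)
  have h2 : ∫ s in p..t, (t - s) ^ (-α) * (s - p) ^ (-β)
      = ∫ x in (0:ℝ)..(t - p), x ^ (-β) * (t - p - x) ^ (-α) := by
    have := intervalIntegral.integral_comp_sub_right (a := p) (b := t)
      (fun x : ℝ => x ^ (-β) * (t - p - x) ^ (-α)) p
    rw [sub_self] at this
    rw [← this]
    apply intervalIntegral.integral_congr
    intro s _
    simp only
    rw [mul_comm]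
    ring_nf
  rw [Complex.betaIntegral_eq_Gamma_mul_div _ _ (by simpa using hβ) (by simpa using hα)] at h1
  have h3 : ∫ x in (0:ℝ)..(t - p), (x : ℂ) ^ (((1 - β : ℝ) : ℂ) - 1) *
      (((t - p : ℝ) : ℂ) - x) ^ (((1 - α : ℝ) : ℂ) - 1)
      = ((∫ x in (0:ℝ)..(t - p), x ^ (-β) * (t - p - x) ^ (-α) : ℝ) : ℂ) := by
    rw [← intervalIntegral.integral_ofReal]
    apply intervalIntegral.integral_congr
    intro x hx
    rw [Set.uIcc_of_le (by linarith)] at hx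
    simp only
    rw [Complex.ofReal_mul, Complex.ofReal_cpow hx.1, Complex.ofReal_cpow (by linarith [hx.2])]
    push_cast
    ring_nf
  rw [h3, ← Complex.ofReal_add, Complex.Gamma_ofReal, Complex.Gamma_ofReal, Complex.Gamma_ofReal,
    ← Complex.ofReal_one, ← Complex.ofReal_sub, ← Complex.ofReal_cpow (by linarith)] at h1
  rw [h2]
  have h4 : ∫ x in (0:ℝ)..(t - p), x ^ (-β) * (t - p - x) ^ (-α)
      = (t - p) ^ (1 - β + (1 - α) - 1) * (Real.Gamma (1 - β) * Real.Gamma (1 - α) /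
        Real.Gamma (1 - β + (1 - α))) := by exact_mod_cast h1
  rw [h4, show 1 - β + (1 - α) = 2 - α - β by ring, show 2 - α - β - 1 = 1 - α - β by ring]
  ring

open MeasureTheory in
lemma fubini_part {α β : ℝ} (hα : α < 1) (hβ : β < 1) {a t : ℝ} (h : a < t) (g : ℝ → ℝ)
    (hg : Measurable g) (M : ℝ) (hM : ∀ x ∈ Icc a t, |g x| ≤ M) :
    ∫ s in a..t, (t - s) ^ (-α) * ∫ τ in a..s, (s - τ) ^ (-β) * g τ
      = Real.Gamma (1 - α) * Real.Gamma (1 - β) / Real.Gamma (2 - α - β)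
        * ∫ τ in a..t, (t - τ) ^ (1 - α - β) * g τ := by
  set μ := (volume : Measure ℝ).restrict (Ioc a t) with hμ
  let K : ℝ → ℝ → ℝ := fun s τ => if τ < s then (t - s) ^ (-α) * (s - τ) ^ (-β) else 0
  have hKm : Measurable (Function.uncurry K) := by
    refine Measurable.ite (measurableSet_lt measurable_snd measurable_fst) ?_ measurable_const
    exact (((measurable_const.sub measurable_fst).pow_const _).mul
      ((measurable_fst.sub measurable_snd).pow_const _))
  have hKind : ∀ s, K s = (Iio s).indicator (fun τ => (t - s) ^ (-α) * (s - τ) ^ (-β)) := by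
    intro s; ext τ; simp [K, indicator]
  have hset : ∀ s ∈ Ioc a t, Iio s ∩ Ioc a t = Ioo a s := by
    intro s hs; ext x; simp only [mem_inter_iff, mem_Iio, mem_Ioc, mem_Ioo]
    constructor
    · rintro ⟨h1, h2, h3⟩; exact ⟨h2, h1⟩
    · rintro ⟨h1, h2⟩; exact ⟨h2, h1, by linarith [hs.2]⟩
  have hsec : ∀ s ∈ Ioc a t, ∀ u : ℝ → ℝ, ∫ τ, K s τ * u τ ∂μ
      = (t - s) ^ (-α) * ∫ τ in a..s, (s - τ) ^ (-β) * u τ := by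
    intro s hs u
    have : (fun τ => K s τ * u τ)
        = (Iio s).indicator (fun τ => (t - s) ^ (-α) * ((s - τ) ^ (-β) * u τ)) := by
      ext τ; simp only [K, indicator, mem_Iio]; split_ifs <;> ring
    rw [this, integral_indicator measurableSet_Iio, hμ, Measure.restrict_restrict measurableSet_Iio,
      hset s hs, ← integral_Ioc_eq_integral_Ioo, ← intervalIntegral.integral_of_le hs.1.le,
      intervalIntegral.integral_const_mul]
  have hKpos : ∀ s ∈ Ioc a t, ∀ τ, 0 ≤ K s τ := by
    intro s hs τ
    simp only [K]
    split_ifs with hh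
    · exact mul_nonneg (Real.rpow_nonneg (by linarith [hs.2]) _) (Real.rpow_nonneg (by linarith) _)
    · exact le_rfl
  have hKint : Integrable (Function.uncurry K) (μ.prod μ) := by
    rw [integrable_prod_iff hKm.aestronglyMeasurable]
    constructor
    · filter_upwards [ae_restrict_mem measurableSet_Ioc] with s hs
      change Integrable (K s) μ
      rw [hKind, integrable_indicator_iff measurableSet_Iio, IntegrableOn, hμ,
        Measure.restrict_restrict measurableSet_Iio, hset s hs]
      have := ((ker_int hβ a s s).const_mul ((t - s) ^ (-α)))
      rw [intervalIntegrable_iff_integrableOn_Ioo_of_le hs.1.le] at this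
      exact this
    · have h1 : IntervalIntegrable (fun s => (t - s) ^ (-α) * ((s - a) ^ (1 - β) / (1 - β)))
          volume a t := by
        apply (ker_int hα a t t).mul_continuousOn
        apply ContinuousOn.div_const
        exact ContinuousOn.rpow_const (by fun_prop) (fun x _ => Or.inr (by linarith))
      rw [intervalIntegrable_iff_integrableOn_Ioc_of_le h.le] at h1
      refine Integrable.congr h1 ?_
      filter_upwards [ae_restrict_mem measurableSet_Ioc] with s hs
      have h2 := hsec s hs (fun _ => 1)
      simp only [mul_one] at h2
      rw [← ker_val hβ, ← h2]
      apply integral_congr_ae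
      filter_upwards with τ
      rw [Function.uncurry_apply_pair, Real.norm_of_nonneg (hKpos s hs τ)]
  have hint : Integrable (Function.uncurry (fun s τ => K s τ * g τ)) (μ.prod μ) := by
    refine Integrable.mono' (hKint.mul_const M) ?_ ?_
    · exact (hKm.mul (hg.comp measurable_snd)).aestronglyMeasurable
    · have : ∀ᵐ z ∂(μ.prod μ), z ∈ (Ioc a t) ×ˢ (Ioc a t) := by
        rw [hμ, Measure.prod_restrict]
        exact ae_restrict_mem (measurableSet_Ioc.prod measurableSet_Ioc)
      filter_upwards [this] with z hz
      obtain ⟨s, τ⟩ := z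
      simp only [Function.uncurry_apply_pair, norm_mul, Real.norm_eq_abs]
      rw [abs_of_nonneg (hKpos s hz.1 τ)]
      exact mul_le_mul_of_nonneg_left (hM τ (Ioc_subset_Icc_self hz.2)) (hKpos s hz.1 τ)
  have hsw := integral_integral_swap hint
  have hL : ∫ s in a..t, (t - s) ^ (-α) * ∫ τ in a..s, (s - τ) ^ (-β) * g τ
      = ∫ s, ∫ τ, K s τ * g τ ∂μ ∂μ := by
    rw [intervalIntegral.integral_of_le h.le]
    apply setIntegral_congr_fun measurableSet_Ioc
    intro s hs
    exact (hsec s hs g).symm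
  rw [hL, hsw, intervalIntegral.integral_of_le h.le, ← integral_const_mul,
    integral_Ioc_eq_integral_Ioo, hμ, integral_Ioc_eq_integral_Ioo]
  apply setIntegral_congr_fun measurableSet_Ioo
  intro τ hτ
  simp only
  rw [MeasureTheory.integral_mul_const, ← mul_assoc, ← beta_val hα hβ hτ.2]
  congr 1
  have : (fun s => K s τ)
      = (Ioi τ).indicator (fun s => (t - s) ^ (-α) * (s - τ) ^ (-β)) := by
    ext s; simp [K, indicator]
  have hs2 : Ioi τ ∩ Ioc a t = Ioc τ t := by
    ext x; simp only [mem_inter_iff, mem_Ioi, mem_Ioc]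
    constructor
    · rintro ⟨h1, h2, h3⟩; exact ⟨h1, h3⟩
    · rintro ⟨h1, h2⟩; exact ⟨h1, by linarith [hτ.1], h2⟩
  rw [this, integral_indicator measurableSet_Ioi, Measure.restrict_restrict measurableSet_Ioi, hs2,
    ← intervalIntegral.integral_of_le hτ.2.le]

open MeasureTheory in
lemma parts_formula {c : ℝ} (hc : c < 1) {a t : ℝ} (h : a < t) (f : ℝ → ℝ) (y : ℝ)
    (hf : ∀ x ∈ Icc a t, HasDerivAt f (deriv f x) x)
    (hf' : ContinuousOn (deriv f) (Icc a t)) :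
    ∫ τ in a..t, (t - τ) ^ (1 - c) * deriv f τ
      = (t - a) ^ (1 - c) * (y - f a) - (1 - c) * ∫ τ in a..t, (t - τ) ^ (-c) * (y - f τ) := by
  have := intervalIntegral.integral_mul_deriv_eq_deriv_mul_of_hasDerivAt (a := a) (b := t)
    (u := fun τ => (t - τ) ^ (1 - c)) (v := fun τ => f τ - y)
    (u' := fun τ => -((1 - c) * (t - τ) ^ (-c))) (v' := deriv f)
    (ContinuousOn.rpow_const (by fun_prop) (fun x _ => Or.inr (by linarith)))
    (by
      rw [uIcc_of_le h.le]
      exact ContinuousOn.sub (fun x hx => (hf x hx).continuousAt.continuousWithinAt)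
        continuousOn_const)
    (by
      intro x hx
      rw [min_eq_left h.le, max_eq_right h.le] at hx
      have h1 := ((hasDerivAt_id' x).const_sub t).rpow_const (p := 1 - c)
        (Or.inl (by linarith [hx.2]))
      refine h1.congr_deriv ?_
      change -1 * (1 - c) * (t - x) ^ (1 - c - 1) = -((1 - c) * (t - x) ^ (-c))
      rw [show 1 - c - 1 = -c by ring]
      ring)
    (by
      intro x hx
      rw [min_eq_left h.le, max_eq_right h.le] at hx
      exact (hf x (Ioo_subset_Icc_self hx)).sub_const y)
    ((ker_int hc a t t).const_mul _).neg
    (by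
      apply ContinuousOn.intervalIntegrable
      rwa [uIcc_of_le h.le])
  rw [this, ← intervalIntegral.integral_const_mul, sub_self, Real.zero_rpow (by linarith)]
  have h2 : ∫ x in a..t, -((1 - c) * (t - x) ^ (-c)) * (f x - y)
      = ∫ x in a..t, (1 - c) * ((t - x) ^ (-c) * (y - f x)) := by
    apply intervalIntegral.integral_congr
    intro x _
    simp only
    ring
  rw [h2]
  ring

open MeasureTheory in
lemma seqAux_formula {α β : ℝ} (hα : α < 1) (hβ : β < 1) {a t : ℝ} (h : a < t)
    (f : ℝ → ℝ) (hf' : ContinuousOn (deriv f) (Icc a t)) :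
    seqCaputoAux α β a f t = 1 / Real.Gamma (2 - α - β) *
      ∫ τ in a..t, (t - τ) ^ (1 - (α + β)) * deriv f τ := by
  obtain ⟨M, hM⟩ := isCompact_Icc.exists_bound_of_continuousOn hf'
  have h1 := fubini_part hα hβ h (deriv f) (measurable_deriv f) M hM
  have h2 : ∫ s in a..t, (t - s) ^ (-α) * caputo β a f s = 1 / Real.Gamma (1 - β) *
      ∫ s in a..t, (t - s) ^ (-α) * ∫ τ in a..s, (s - τ) ^ (-β) * deriv f τ := by
    rw [← intervalIntegral.integral_const_mul]
    apply intervalIntegral.integral_congr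
    intro s _
    simp only [caputo]
    ring
  have g1 := (Real.Gamma_pos_of_pos (sub_pos.2 hα)).ne'
  have g2 := (Real.Gamma_pos_of_pos (sub_pos.2 hβ)).ne'
  rw [seqCaputoAux, h2, h1, sub_sub 1 α β]
  field_simp

open MeasureTheory in
lemma G_bound {c : ℝ} (hc0 : 0 < c) (hc : c < 1) {a x t M : ℝ} (hax : a < x) (hxt : x < t)
    (k : ℝ → ℝ) (hk : ContinuousOn k (Icc a t)) (hk0 : ∀ s ∈ Icc a t, 0 ≤ k s)
    (hkM : ∀ s ∈ Icc x t, k s ≤ M * (t - x)) :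
    (1 - c) * (∫ s in a..t, (t - s) ^ (-c) * k s)
      ≤ (1 - c) * (∫ s in a..x, (x - s) ^ (-c) * k s) + M * (t - x) ^ (2 - c) := by
  have i1 : IntervalIntegrable (fun s => (t - s) ^ (-c) * k s) volume a x :=
    (ker_int hc a x t).mul_continuousOn
      (hk.mono (by rw [uIcc_of_le hax.le]; exact Icc_subset_Icc_right hxt.le))
  have i2 : IntervalIntegrable (fun s => (t - s) ^ (-c) * k s) volume x t :=
    (ker_int hc x t t).mul_continuousOn
      (hk.mono (by rw [uIcc_of_le hxt.le]; exact Icc_subset_Icc_left hax.le))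
  have i3 : IntervalIntegrable (fun s => (x - s) ^ (-c) * k s) volume a x :=
    (ker_int hc a x x).mul_continuousOn
      (hk.mono (by rw [uIcc_of_le hax.le]; exact Icc_subset_Icc_right hxt.le))
  have e1 : ∫ s in a..x, (t - s) ^ (-c) * k s ≤ ∫ s in a..x, (x - s) ^ (-c) * k s := by
    apply intervalIntegral.integral_mono_on_of_le_Ioo hax.le i1 i3
    intro s hs
    apply mul_le_mul_of_nonneg_right _ (hk0 s ⟨hs.1.le, by linarith [hs.2]⟩)
    exact Real.rpow_le_rpow_of_nonpos (by linarith [hs.2]) (by linarith) (by linarith)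
  have e2 : ∫ s in x..t, (t - s) ^ (-c) * k s ≤ ∫ s in x..t, (t - s) ^ (-c) * (M * (t - x)) := by
    apply intervalIntegral.integral_mono_on_of_le_Ioo hxt.le i2 ((ker_int hc x t t).mul_const _)
    intro s hs
    exact mul_le_mul_of_nonneg_left (hkM s (Ioo_subset_Icc_self hs))
      (Real.rpow_nonneg (by linarith [hs.2]) _)
  rw [intervalIntegral.integral_mul_const, ker_val hc] at e2
  rw [← intervalIntegral.integral_add_adjacent_intervals i1 i2]
  have e3 : (t - x) ^ (2 - c) = (t - x) ^ (1 - c) * (t - x) := by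
    rw [← Real.rpow_add_one (by linarith)]; ring_nf
  have e4 : (1 - c) * ((t - x) ^ (1 - c) / (1 - c) * (M * (t - x))) = M * (t - x) ^ (2 - c) := by
    rw [e3]
    have : (1 - c) ≠ 0 := by linarith
    field_simp
  have e5 := mul_le_mul_of_nonneg_left (add_le_add e1 e2) (by linarith : 0 ≤ 1 - c)
  rw [mul_add (1 - c) (∫ s in a..x, (x - s) ^ (-c) * k s), e4] at e5
  linarith

lemma deriv_nonneg_of_right {φ : ℝ → ℝ} {d x b : ℝ} (hxb : x < b) (hd : HasDerivAt φ d x)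
    (h : ∀ t ∈ Ioo x b, φ x ≤ φ t) : 0 ≤ d := by
  have h1 := (hasDerivWithinAt_iff_tendsto_slope' (s := Ioi x) (by simp)).1
    (hd.hasDerivWithinAt (s := Ioi x))
  apply ge_of_tendsto h1
  filter_upwards [Ioo_mem_nhdsGT hxb] with t ht
  rw [slope_def_field]
  exact div_nonneg (by linarith [h t ht]) (by linarith [ht.1])

/-- extremum estimate for the sequential Caputo derivative at an
interior maximum point, in the case `α + β < 1`. -/
theorem seqCaputo_max_estimate_of_lt_one
    (α β a b : ℝ) (f : ℝ → ℝ) (xs : ℝ)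
    (hα0 : 0 < α) (hα1 : α < 1) (hβ0 : 0 < β) (hβ1 : β < 1)
    (hsum : α + β < 1) (hab : a < b)
    (hf : ∀ x ∈ Set.Icc a b, HasDerivAt f (deriv f x) x)
    (hf' : ContinuousOn (deriv f) (Set.Icc a b))
    (hex : ∀ x ∈ Set.Ioo a b,
      HasDerivAt (seqCaputoAux α β a f) (seqCaputo α β a f x) x)
    (hcont : ∃ g : ℝ → ℝ, ContinuousOn g (Set.Icc a b) ∧
      ∀ x ∈ Set.Ioo a b, g x = seqCaputo α β a f x)
    (hxs : xs ∈ Set.Ioo a b)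
    (hmax : ∀ x ∈ Set.Icc a b, f x ≤ f xs) :
    (α + β - 1) / Real.Gamma (2 - α - β) * (xs - a) ^ (-(α + β)) * (f a - f xs)
        ≤ seqCaputo α β a f xs ∧
      0 ≤ (α + β - 1) / Real.Gamma (2 - α - β) * (xs - a) ^ (-(α + β)) * (f a - f xs) := by
  obtain ⟨hax, hxb⟩ := hxs
  have hc : 0 < 1 - (α + β) := by linarith
  have hΓ : 0 < Real.Gamma (2 - α - β) := Real.Gamma_pos_of_pos (by linarith)
  have hfa : f a ≤ f xs := hmax a ⟨le_rfl, hab.le⟩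
  refine ⟨?_, ?_⟩
  swap
  · have h1 : (α + β - 1) / Real.Gamma (2 - α - β) ≤ 0 :=
      div_nonpos_of_nonpos_of_nonneg (by linarith) hΓ.le
    exact mul_nonneg_of_nonpos_of_nonpos
      (mul_nonpos_of_nonpos_of_nonneg h1 (Real.rpow_nonneg (by linarith) _)) (by linarith)
  obtain ⟨M, hM⟩ := isCompact_Icc.exists_bound_of_continuousOn hf'
  have hfc : ContinuousOn f (Icc a b) :=
    fun x hx => (hf x hx).continuousAt.continuousWithinAt
  have hF : ∀ t ∈ Ioo a b, seqCaputoAux α β a f t = 1 / Real.Gamma (2 - α - β) *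
      ((t - a) ^ (1 - (α + β)) * (f xs - f a)
        - (1 - (α + β)) * ∫ τ in a..t, (t - τ) ^ (-(α + β)) * (f xs - f τ)) := by
    intro t ht
    have hsub : Icc a t ⊆ Icc a b := Icc_subset_Icc_right ht.2.le
    rw [seqAux_formula hα1 hβ1 ht.1 f (hf'.mono hsub),
      parts_formula hsum ht.1 f (f xs) (fun x hx => hf x (hsub hx)) (hf'.mono hsub)]
  let φ : ℝ → ℝ := fun t => seqCaputoAux α β a f t
    - 1 / Real.Gamma (2 - α - β) * ((t - a) ^ (1 - (α + β)) * (f xs - f a))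
    + 1 / Real.Gamma (2 - α - β) * (M * (t - xs) ^ (2 - (α + β)))
  have hd1 : HasDerivAt (fun t : ℝ => (t - a) ^ (1 - (α + β)))
      ((1 - (α + β)) * (xs - a) ^ (-(α + β))) xs := by
    have h1 := ((hasDerivAt_id' xs).sub_const a).rpow_const (p := 1 - (α + β))
        (Or.inl (by linarith))
    convert h1 using 1
    ring_nf
  have hd2 : HasDerivAt (fun t : ℝ => (t - xs) ^ (2 - (α + β))) 0 xs := by
    have h1 := ((hasDerivAt_id' xs).sub_const xs).rpow_const (p := 2 - (α + β))
        (Or.inr (by linarith))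
    convert h1 using 1
    rw [sub_self]
    rw [Real.zero_rpow (by linarith)]
    ring
  have hφ := ((hex xs ⟨hax, hxb⟩).sub ((hd1.mul_const (f xs - f a)).const_mul
    (1 / Real.Gamma (2 - α - β)))).add ((hd2.const_mul M).const_mul (1 / Real.Gamma (2 - α - β)))
  have key := deriv_nonneg_of_right hxb hφ (by
    intro t ht
    have hta : a < t := hax.trans ht.1
    have hsub : Icc a t ⊆ Icc a b := Icc_subset_Icc_right ht.2.le
    have hG := G_bound (c := α + β) (by linarith) hsum (M := M) hax ht.1 (fun s => f xs - f s)
      (continuousOn_const.sub (hfc.mono hsub))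
      (fun s hs => sub_nonneg.2 (hmax s (hsub hs)))
      (by
        intro s hs
        have hs' : ∀ z ∈ Icc xs t, z ∈ Icc a b := fun z hz =>
          ⟨by linarith [hz.1], by linarith [hz.2, ht.2]⟩
        have h1 := (convex_Icc xs t).norm_image_sub_le_of_norm_hasDerivWithin_le
          (fun z hz => (hf z (hs' z hz)).hasDerivWithinAt) (fun z hz => hM z (hs' z hz))
          (⟨hs.1, hs.2⟩ : s ∈ Icc xs t) (⟨le_rfl, ht.1.le⟩ : xs ∈ Icc xs t)
        have hM0 : 0 ≤ M := (norm_nonneg _).trans (hM a ⟨le_rfl, hab.le⟩)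
        rw [Real.norm_eq_abs, Real.norm_eq_abs, abs_sub_comm xs s,
          abs_of_nonneg (sub_nonneg.2 hs.1)] at h1
        have h2 := mul_le_mul_of_nonneg_left (sub_le_sub_right hs.2 xs) hM0
        exact (le_abs_self _).trans (h1.trans h2))
    simp only [Pi.add_apply, Pi.sub_apply]
    rw [hF t ⟨hta, ht.2⟩, hF xs ⟨hax, hxb⟩, sub_self, Real.zero_rpow (by linarith)]
    have h3 := mul_le_mul_of_nonneg_left hG (one_div_pos.2 hΓ).le
    linarith)
  have e : (α + β - 1) / Real.Gamma (2 - α - β) * (xs - a) ^ (-(α + β)) * (f a - f xs)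
      = 1 / Real.Gamma (2 - α - β) * ((1 - (α + β)) * (xs - a) ^ (-(α + β)) * (f xs - f a)) := by
    ring
  rw [e]
  linarith
end

section
/- Let 0 < α < 1, 0 < β₁, β₂ < 1 with 1 < β₁ + β₂, ν > 0, −∞ < a < b < +∞, T > 0, and set Ω = (a,b) × (0,T]. Let u : [a,b] × [0,T] → ℝ be continuous such that for each t ∈ [0,T] the map x ↦ u(x,t) is continuously differentiable on [a,b], for each x ∈ [a,b] the map t ↦ u(x,t) is continuously differentiable on (0,T], and the partial fractional derivatives 𝒟^α_{0+,t} u and 𝒟^{β₁}_{a+,x}𝒟^{β₂}_{a+,x} u exist and are continuous on [a,b] × [0,T]. Suppose u satisfies 𝒟^α_{0+,t} u(x,t) = ν · 𝒟^{β₁}_{a+,x}𝒟^{β₂}_{a+,x} u(x,t) + F(x,t) on Ω, u(x,0) = φ(x) for x ∈ [a,b], and u(a,t) = ϕ(t), u(b,t) = ψ(t) for t ∈ [0,T], with F, φ, ϕ, ψ continuous. If F(x,t) ≥ 0 on [a,b] × [0,T], then u(x,t) ≥ min{ inf_{t∈[0,T]} ϕ(t), inf_{t∈[0,T]} ψ(t),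 inf_{x∈[a,b]} φ(x) } for all (x,t) ∈ [a,b] × [0,T]. -/
open Set

open MeasureTheory Filter Topology in
lemma tendsto_rpow_mul_zero {γ c d : ℝ} {G : ℝ → ℝ} (hγ : γ < 1)
    (hG : HasDerivAt G d c) (hc : G c = 0) :
    Tendsto (fun s => (c - s) ^ (-γ) * G s) (𝓝[<] c) (𝓝 0) := by
  have h1 : Tendsto (slope G c) (𝓝[<] c) (𝓝 d) :=
    hG.tendsto_slope.mono_left (nhdsWithin_mono _ (fun x hx => ne_of_lt hx))
  have h2 : Tendsto (fun s : ℝ => (c - s) ^ (1 - γ)) (𝓝[<] c) (𝓝 0) := by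
    have : ContinuousAt (fun s : ℝ => (c - s) ^ (1 - γ)) c := by
      apply ContinuousAt.rpow_const (by fun_prop)
      right; linarith
    have h := this.tendsto
    simp only [sub_self] at h
    rw [Real.zero_rpow (by linarith)] at h
    exact h.mono_left nhdsWithin_le_nhds
  have h3 := (h2.mul h1).neg
  simp only [zero_mul, neg_zero] at h3
  refine h3.congr' ?_
  filter_upwards [self_mem_nhdsWithin] with s hs
  have hs' : 0 < c - s := sub_pos.2 hs
  have : (c - s) ^ (1 - γ) = (c - s) ^ (-γ) * (c - s) := by
    rw [← Real.rpow_add_one hs'.ne']; ring_nf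
  rw [this, slope_def_field, hc]
  have h0 : s - c ≠ 0 := by linarith
  field_simp
  ring

open MeasureTheory Filter Topology in
lemma kernel_ibp {γ a c y e : ℝ} {G : ℝ → ℝ} (hγ0 : 0 < γ) (hγ : γ < 1) (hac : a < c)
    (hcy : c < y) (he0 : 0 ≤ e) (he1 : e ≤ 1)
    (hGc : ContinuousOn G (Icc a c)) (hG : ∀ s ∈ Ioc a c, HasDerivAt G (deriv G s) s)
    (hpos : ∀ s ∈ Icc a c, 0 ≤ G s) (h0 : G c = 0)
    (hint : IntervalIntegrable (fun s => ((c - s) ^ (-γ) - e * (y - s) ^ (-γ)) * deriv G s)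
      volume a c) :
    ∫ s in a..c, ((c - s) ^ (-γ) - e * (y - s) ^ (-γ)) * deriv G s
      ≤ - (((c - a) ^ (-γ) - e * (y - a) ^ (-γ)) * G a) := by
  have key := intervalIntegral.integral_le_sub_of_hasDeriv_right_of_le
    (g := fun s => ((c - s) ^ (-γ) - e * (y - s) ^ (-γ)) * G s)
    (g' := fun s => ((-1) * (-γ) * (c - s) ^ (-γ - 1) - e * ((-1) * (-γ) * (y - s) ^ (-γ - 1))) * G s
      + ((c - s) ^ (-γ) - e * (y - s) ^ (-γ)) * deriv G s)
    (φ := fun s => ((c - s) ^ (-γ) - e * (y - s) ^ (-γ)) * deriv G s) hac.le ?_ ?_ ?_ ?_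
  · simpa [h0] using key
  · intro s hs
    have hyc : ContinuousWithinAt (fun s => (y - s) ^ (-γ)) (Icc a c) s := by
      apply ContinuousWithinAt.rpow_const
      · fun_prop
      · left; have := hs.2; simp only [ne_eq]; linarith
    rcases hs.2.lt_or_eq with h | h
    · have hcc : ContinuousWithinAt (fun s => (c - s) ^ (-γ)) (Icc a c) s := by
        apply ContinuousWithinAt.rpow_const
        · fun_prop
        · left; simp only [ne_eq]; linarith
      exact (hcc.sub (continuousWithinAt_const.mul hyc)).mul (hGc s hs)
    · subst h
      have hd := hG s ⟨hac, le_rfl⟩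
      have h1 : ContinuousWithinAt (fun r => (s - r) ^ (-γ) * G r) (Icc a s) s := by
        have h2 := tendsto_rpow_mul_zero hγ hd h0
        have h3 : ContinuousWithinAt (fun r => (s - r) ^ (-γ) * G r) (Iio s) s := by
          unfold ContinuousWithinAt
          simpa [h0] using h2
        have h4 := h3.insert
        rw [Iio_insert] at h4
        exact h4.mono Icc_subset_Iic_self
      have h5 := h1.sub ((continuousWithinAt_const (b := e)).mul (hyc.mul (hGc s hs)))
      refine h5.congr (fun r _ => ?_) ?_ <;> simp only [Pi.sub_apply, Pi.mul_apply] <;> ring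
  · intro s hs
    have h1 : HasDerivAt (fun s => (c - s) ^ (-γ)) ((-1) * (-γ) * (c - s) ^ (-γ - 1)) s :=
      ((hasDerivAt_id s).const_sub c).rpow_const (Or.inl (by have := hs.2; simp only [id]; linarith))
    have h2 : HasDerivAt (fun s => (y - s) ^ (-γ)) ((-1) * (-γ) * (y - s) ^ (-γ - 1)) s :=
      ((hasDerivAt_id s).const_sub y).rpow_const (Or.inl (by have := hs.2; simp only [id]; linarith))
    exact ((h1.sub (h2.const_mul e)).mul (hG s ⟨hs.1, hs.2.le⟩)).hasDerivWithinAt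
  · rwa [← intervalIntegrable_iff_integrableOn_Icc_of_le hac.le]
  · intro s hs
    have hs2 := hs.2
    have h1 : (y - s) ^ (-γ - 1) ≤ (c - s) ^ (-γ - 1) :=
      Real.rpow_le_rpow_of_nonpos (by linarith) (by linarith) (by linarith)
    have h2 : 0 ≤ (y - s) ^ (-γ - 1) := Real.rpow_nonneg (by linarith) _
    have h3 : e * (y - s) ^ (-γ - 1) ≤ (c - s) ^ (-γ - 1) := by nlinarith
    have h4 : 0 ≤ γ * ((c - s) ^ (-γ - 1) - e * (y - s) ^ (-γ - 1)) * G s :=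
      mul_nonneg (mul_nonneg hγ0.le (by linarith)) (hpos s ⟨hs.1.le, hs.2.le⟩)
    nlinarith

open MeasureTheory Filter Topology in
lemma beta_int_pos {p q : ℝ} (hp : p < 1) (hq : q < 1) :
    0 < ∫ r in (0:ℝ)..1, (1 - r) ^ (-p) * r ^ (-q) := by
  apply intervalIntegral.intervalIntegral_pos_of_pos_on _ _ one_pos
  · have h := (Complex.betaIntegral_convergent (u := ((1 - q : ℝ) : ℂ)) (v := ((1 - p : ℝ) : ℂ))
      (by simpa using hq) (by simpa using hp)).norm
    rw [intervalIntegrable_iff_integrableOn_Ioo_of_le zero_le_one] at h ⊢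
    refine h.congr_fun (fun r hr => ?_) measurableSet_Ioo
    have h1 : ((1 : ℂ) - (r : ℂ)) = ((1 - r : ℝ) : ℂ) := by push_cast; rfl
    simp only [norm_mul]
    rw [h1, Complex.norm_cpow_eq_rpow_re_of_pos hr.1,
      Complex.norm_cpow_eq_rpow_re_of_pos (by linarith [hr.2])]
    simp only [Complex.sub_re, Complex.ofReal_re, Complex.one_re]
    rw [mul_comm]
    ring_nf
  · intro r hr
    exact mul_pos (Real.rpow_pos_of_pos (by linarith [hr.2]) _) (Real.rpow_pos_of_pos hr.1 _)

open MeasureTheory Filter Topology in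
lemma beta_scale {p q s x : ℝ} (hsx : s < x) :
    ∫ y in s..x, (x - y) ^ (-p) * (y - s) ^ (-q) =
      (∫ r in (0:ℝ)..1, (1 - r) ^ (-p) * r ^ (-q)) * (x - s) ^ (1 - p - q) := by
  have hL : 0 < x - s := by linarith
  have h := intervalIntegral.integral_comp_add_mul (a := 0) (b := 1)
    (fun y => (x - y) ^ (-p) * (y - s) ^ (-q)) hL.ne' s
  have e1 : s + (x - s) * 0 = s := by ring
  have e2 : s + (x - s) * 1 = x := by ring
  rw [e1, e2, smul_eq_mul] at h
  have h2 : ∫ y in s..x, (x - y) ^ (-p) * (y - s) ^ (-q) = (x - s) *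
      ∫ r in (0:ℝ)..1, (x - (s + (x - s) * r)) ^ (-p) * ((s + (x - s) * r) - s) ^ (-q) := by
    rw [h]; field_simp
  rw [h2, ← intervalIntegral.integral_const_mul, ← intervalIntegral.integral_mul_const]
  apply intervalIntegral.integral_congr
  intro r hr
  rw [uIcc_of_le zero_le_one] at hr
  simp only
  have e3 : x - (s + (x - s) * r) = (x - s) * (1 - r) := by ring
  have e4 : s + (x - s) * r - s = (x - s) * r := by ring
  rw [e3, e4, Real.mul_rpow hL.le (by linarith [hr.2]), Real.mul_rpow hL.le hr.1]
  have e5 : (x - s) ^ (1 - p - q) = (x - s) * (x - s) ^ (-p) * (x - s) ^ (-q) := by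
    have : 1 - p - q = 1 + -p + -q := by ring
    rw [this, Real.rpow_add hL, Real.rpow_add hL, Real.rpow_one]
  rw [e5]; ring

/-- truncated power kernel -/
noncomputable def trKer (p L : ℝ) : ℝ → ℝ := (Ioo 0 L).indicator (fun r => r ^ (-p))

open MeasureTheory Filter Topology in
lemma trKer_integrable {p L : ℝ} (hp : p < 1) (hL : 0 < L) : Integrable (trKer p L) := by
  unfold trKer
  rw [integrable_indicator_iff measurableSet_Ioo,
    ← intervalIntegrable_iff_integrableOn_Ioo_of_le hL.le]
  exact intervalIntegral.intervalIntegrable_rpow' (by linarith)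

open MeasureTheory Filter Topology in
lemma abel_comp {a x p q : ℝ} {g : ℝ → ℝ} (hax : a < x) (hp : p < 1) (hq : q < 1)
    (hg : ContinuousOn g (Icc a x)) :
    IntervalIntegrable (fun y => (x - y) ^ (-p) * ∫ s in a..y, (y - s) ^ (-q) * g s) volume a x ∧
    ∫ y in a..x, (x - y) ^ (-p) * ∫ s in a..y, (y - s) ^ (-q) * g s =
      (∫ r in (0:ℝ)..1, (1 - r) ^ (-p) * r ^ (-q)) *
        ∫ s in a..x, (x - s) ^ (1 - p - q) * g s := by
  have hL : 0 < x - a := by linarith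
  set gt : ℝ → ℝ := (Ioo a x).indicator g with hgt
  have hgm : AEStronglyMeasurable gt volume :=
    (aestronglyMeasurable_indicator_iff measurableSet_Ioo).2
      ((hg.mono Ioo_subset_Icc_self).aestronglyMeasurable measurableSet_Ioo)
  obtain ⟨M, hM⟩ := (isCompact_Icc.image_of_continuousOn hg).isBounded.exists_norm_le
  have hgb : ∀ s, ‖gt s‖ ≤ max M 0 := by
    intro s
    by_cases hs : s ∈ Ioo a x
    · rw [hgt, indicator_of_mem hs]
      exact (hM _ (mem_image_of_mem _ (Ioo_subset_Icc_self hs))).trans (le_max_left _ _)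
    · rw [hgt, indicator_of_notMem hs]; simp
  set Φ : ℝ → ℝ → ℝ := fun s y => gt s * (trKer p (x - a) (x - y) * trKer q (x - a) (y - s)) with hΦ
  have hInt : Integrable (Function.uncurry Φ) (volume.prod volume) := by
    have h1 : Integrable (fun y => trKer p (x - a) (x - y)) :=
      (trKer_integrable hp hL).comp_sub_left x
    have h2 : Integrable (fun y => trKer q (x - a) (-y)) := (trKer_integrable hq hL).comp_neg
    have h3 := Integrable.convolution_integrand (ContinuousLinearMap.mul ℝ ℝ) h1 h2
    have h4 := h3.bdd_mul (f := fun z : ℝ × ℝ => gt z.1) (c := max M 0) hgm.comp_fst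
      (Eventually.of_forall fun z => hgb z.1)
    refine h4.congr (Eventually.of_forall fun z => ?_)
    simp [hΦ, Function.uncurry]
  have hA : (fun y => ∫ s, Φ s y) = (Ioo a x).indicator
      (fun y => (x - y) ^ (-p) * ∫ s in a..y, (y - s) ^ (-q) * g s) := by
    funext y
    by_cases hy : y ∈ Ioo a x
    · rw [indicator_of_mem hy, intervalIntegral.integral_of_le hy.1.le,
        integral_Ioc_eq_integral_Ioo, ← integral_const_mul, ← integral_indicator measurableSet_Ioo]
      congr 1
      funext s
      have hy1 := hy.1
      have hy2 := hy.2
      have hk : trKer p (x - a) (x - y) = (x - y) ^ (-p) := by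
        unfold trKer; rw [indicator_of_mem]; constructor <;> linarith
      simp only [hΦ, hk]
      by_cases hs : s ∈ Ioo a y
      · have hs1 := hs.1
        have hs2 := hs.2
        have hk2 : trKer q (x - a) (y - s) = (y - s) ^ (-q) := by
          unfold trKer; rw [indicator_of_mem]; constructor <;> linarith
        rw [indicator_of_mem hs, hk2, hgt, indicator_of_mem (show s ∈ Ioo a x from ⟨hs1, hs2.trans hy2⟩)]
        ring
      · rw [indicator_of_notMem hs]
        by_cases hs1 : a < s
        · have hk2 : trKer q (x - a) (y - s) = 0 := by
            unfold trKer; rw [indicator_of_notMem]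
            intro h; exact hs ⟨hs1, by linarith [h.1]⟩
          rw [hk2]; ring
        · rw [hgt, indicator_of_notMem (fun h => hs1 h.1)]; ring
    · rw [indicator_of_notMem hy]
      have hk : trKer p (x - a) (x - y) = 0 := by
        unfold trKer; rw [indicator_of_notMem]
        intro h; exact hy ⟨by linarith [h.2], by linarith [h.1]⟩
      simp [hΦ, hk]
  have hB : (fun s => ∫ y, Φ s y) = (Ioo a x).indicator
      (fun s => (∫ r in (0:ℝ)..1, (1 - r) ^ (-p) * r ^ (-q)) * ((x - s) ^ (1 - p - q) * g s)) := by
    funext s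
    by_cases hs : s ∈ Ioo a x
    · have hs1 := hs.1
      have hs2 := hs.2
      rw [indicator_of_mem hs, ← mul_assoc, ← beta_scale hs.2,
        intervalIntegral.integral_of_le hs.2.le, integral_Ioc_eq_integral_Ioo,
        ← integral_mul_const, ← integral_indicator measurableSet_Ioo]
      congr 1
      funext y
      simp only [hΦ]
      rw [hgt, indicator_of_mem hs]
      by_cases hy : y ∈ Ioo s x
      · have hy1 := hy.1
        have hy2 := hy.2
        have hk : trKer p (x - a) (x - y) = (x - y) ^ (-p) := by
          unfold trKer; rw [indicator_of_mem]; constructor <;> linarith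
        have hk2 : trKer q (x - a) (y - s) = (y - s) ^ (-q) := by
          unfold trKer; rw [indicator_of_mem]; constructor <;> linarith
        rw [indicator_of_mem hy, hk, hk2]; ring
      · rw [indicator_of_notMem hy]
        by_cases hy1 : s < y
        · have hk : trKer p (x - a) (x - y) = 0 := by
            unfold trKer; rw [indicator_of_notMem]
            intro h; exact hy ⟨hy1, by linarith [h.1]⟩
          rw [hk]; ring
        · have hk2 : trKer q (x - a) (y - s) = 0 := by
            unfold trKer; rw [indicator_of_notMem]
            intro h; exact hy1 (by linarith [h.1])
          rw [hk2]; ring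
    · rw [indicator_of_notMem hs]
      simp only [hΦ]
      rw [hgt, indicator_of_notMem hs]; simp
  constructor
  · have h := hInt.integral_prod_right
    simp only [Function.uncurry] at h
    rw [hA, integrable_indicator_iff measurableSet_Ioo] at h
    rwa [intervalIntegrable_iff_integrableOn_Ioo_of_le hax.le]
  · have h := integral_integral_swap hInt
    rw [hA, hB, integral_indicator measurableSet_Ioo, integral_indicator measurableSet_Ioo,
      integral_const_mul] at h
    rw [intervalIntegral.integral_of_le hax.le, intervalIntegral.integral_of_le hax.le,
      integral_Ioc_eq_integral_Ioo, integral_Ioc_eq_integral_Ioo]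
    exact h.symm

open MeasureTheory Filter Topology in
lemma ker_mul_int {γ l m x : ℝ} {g : ℝ → ℝ} (hγ : γ < 1) (hlm : l ≤ m)
    (hg : ContinuousOn g (Icc l m)) :
    IntervalIntegrable (fun s => (x - s) ^ (-γ) * g s) volume l m := by
  have h1 := (intervalIntegral.intervalIntegrable_rpow' (a := x - l) (b := x - m) (r := -γ)
    (by linarith)).comp_sub_left x
  simp only [sub_sub_cancel] at h1
  exact h1.mul_continuousOn (by rwa [uIcc_of_le hlm])

open MeasureTheory Filter Topology in
lemma space_pos {β₁ β₂ a b x₀ D : ℝ} {f : ℝ → ℝ} (hβ₁ : 0 < β₁ ∧ β₁ < 1)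
    (hβ₂ : 0 < β₂ ∧ β₂ < 1) (hsum : 1 < β₁ + β₂)
    (hf : ∀ x ∈ Icc a b, HasDerivAt f (deriv f x) x)
    (hf' : ContinuousOn (deriv f) (Icc a b)) (hx₀ : x₀ ∈ Ioo a b)
    (hmin : ∀ x ∈ Icc a b, f x₀ ≤ f x) (hlt : f x₀ < f a)
    (hD : HasDerivAt (seqCaputoAux β₁ β₂ a f) D x₀) : 0 < D := by
  obtain ⟨ha, hb⟩ := hx₀
  obtain ⟨γ, hγdef⟩ : ∃ γ, γ = β₁ + β₂ - 1 := ⟨_, rfl⟩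
  have hγ0 : 0 < γ := by linarith
  have hγ1 : γ < 1 := by linarith [hβ₁.2, hβ₂.2]
  set h : ℝ → ℝ := fun x => ∫ s in a..x, (x - s) ^ (-γ) * deriv f s with hh
  obtain ⟨C, hC, hAux⟩ : ∃ C : ℝ, 0 < C ∧ ∀ x ∈ Ioo a b, seqCaputoAux β₁ β₂ a f x = C * h x := by
    refine ⟨(1 / Real.Gamma (1 - β₁)) * ((1 / Real.Gamma (1 - β₂)) *
      ∫ r in (0:ℝ)..1, (1 - r) ^ (-β₁) * r ^ (-β₂)), ?_, ?_⟩
    · have := beta_int_pos hβ₁.2 hβ₂.2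
      have := Real.Gamma_pos_of_pos (s := 1 - β₁) (by linarith [hβ₁.2])
      have := Real.Gamma_pos_of_pos (s := 1 - β₂) (by linarith [hβ₂.2])
      positivity
    · intro x hx
      have h1 := (abel_comp hx.1 hβ₁.2 hβ₂.2 (hf'.mono (Icc_subset_Icc_right hx.2.le))).2
      have e : 1 - β₁ - β₂ = -γ := by rw [hγdef]; ring
      rw [e] at h1
      unfold seqCaputoAux caputo
      rw [mul_assoc, mul_assoc, hh]
      simp only
      rw [← h1, ← intervalIntegral.integral_const_mul (1 / Real.Gamma (1 - β₂))]
      congr 2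
      funext s
      ring
  have hDh : HasDerivAt h (C⁻¹ * D) x₀ := by
    refine (hD.const_mul C⁻¹).congr_of_eventuallyEq ?_
    filter_upwards [Ioo_mem_nhds ha hb] with x hx
    rw [hAux x hx]; field_simp
  set P : ℝ → ℝ := fun y => h y + (f a - f x₀) * (y - a) ^ (-γ) with hP
  have hDP : HasDerivAt P (C⁻¹ * D + (f a - f x₀) * (1 * (-γ) * (x₀ - a) ^ (-γ - 1))) x₀ := by
    refine hDh.add (HasDerivAt.const_mul _ ?_)
    exact ((hasDerivAt_id x₀).sub_const a).rpow_const (Or.inl (by simp only [id]; linarith))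
  -- the right part
  have hstep : ∀ y ∈ Ioo x₀ b, 0 ≤ ∫ s in x₀..y, (y - s) ^ (-γ) * deriv f s → P x₀ ≤ P y := by
    intro y hy hr
    have hy1 := hy.1
    have hcont0 : ContinuousOn (deriv f) (Icc a x₀) := hf'.mono (Icc_subset_Icc_right hb.le)
    have i1 := ker_mul_int (x := y) hγ1 ha.le hcont0
    have i2 := ker_mul_int (x := x₀) hγ1 ha.le hcont0
    have i3 := ker_mul_int (x := y) hγ1 hy.1.le
      (hf'.mono (Icc_subset_Icc ha.le hy.2.le))
    have hderiv : deriv (fun s => f s - f x₀) = deriv f := by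
      funext s; exact deriv_sub_const _
    have hk := kernel_ibp (G := fun s => f s - f x₀) (e := 1) hγ0 hγ1 ha hy.1 zero_le_one le_rfl
      (fun s hs => ((hf s ⟨hs.1, hs.2.trans hb.le⟩).sub_const _).continuousAt.continuousWithinAt)
      (fun s hs => by
        rw [hderiv]; exact (hf s ⟨hs.1.le, hs.2.trans hb.le⟩).sub_const _)
      (fun s hs => sub_nonneg.2 (hmin s ⟨hs.1, hs.2.trans hb.le⟩)) (sub_self _)
      (by
        rw [hderiv]
        refine (i2.sub i1).congr (fun s _ => ?_)
        ring)
    rw [hderiv] at hk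
    have e1 : ∫ s in a..x₀, ((x₀ - s) ^ (-γ) - 1 * (y - s) ^ (-γ)) * deriv f s =
        (∫ s in a..x₀, (x₀ - s) ^ (-γ) * deriv f s) - ∫ s in a..x₀, (y - s) ^ (-γ) * deriv f s := by
      rw [← intervalIntegral.integral_sub i2 i1]
      congr 1
      funext s
      ring
    have e2 := intervalIntegral.integral_add_adjacent_intervals i1 i3
    rw [e1] at hk
    simp only [hP, hh]
    rw [← e2]
    nlinarith
  have hfreq : ∀ δ > 0, ∃ y ∈ Ioo x₀ (x₀ + δ), y < b ∧
      0 ≤ ∫ s in x₀..y, (y - s) ^ (-γ) * deriv f s := by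
    intro δ hδ
    by_contra hcon
    push Not at hcon
    set c := min (x₀ + δ) b with hc
    have hc1 : x₀ < c := lt_min (by linarith) hb
    have hcb : c ≤ b := min_le_right _ _
    have hcδ : c ≤ x₀ + δ := min_le_left _ _
    obtain ⟨hi, he⟩ := abel_comp (p := 1 - γ) (q := γ) hc1 (by linarith) hγ1
      (hf'.mono (Icc_subset_Icc ha.le hcb))
    have hpos := intervalIntegral.intervalIntegral_pos_of_pos_on hi.neg (fun y hy => by
      have hy2 := hy.2
      have h1 := hcon y ⟨hy.1, hy.2.trans_le hcδ⟩ (hy.2.trans_le hcb)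
      have h2 : 0 < (c - y) ^ (-(1 - γ)) := Real.rpow_pos_of_pos (by linarith) _
      simp only [Pi.neg_apply]
      nlinarith) hc1
    simp only [Pi.neg_apply] at hpos
    rw [intervalIntegral.integral_neg, he] at hpos
    have e0 : 1 - (1 - γ) - γ = 0 := by ring
    rw [e0] at hpos
    simp only [Real.rpow_zero, one_mul] at hpos
    have e3 : ∫ s in x₀..c, deriv f s = f c - f x₀ := by
      apply intervalIntegral.integral_eq_sub_of_hasDerivAt
      · intro s hs
        rw [uIcc_of_le hc1.le] at hs
        exact hf s ⟨ha.le.trans hs.1, hs.2.trans hcb⟩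
      · apply ContinuousOn.intervalIntegrable
        rw [uIcc_of_le hc1.le]
        exact hf'.mono (Icc_subset_Icc ha.le hcb)
    rw [e3] at hpos
    have h4 := hmin c ⟨ha.le.trans hc1.le, hcb⟩
    have h5 := beta_int_pos (p := 1 - γ) (q := γ) (by linarith) hγ1
    nlinarith
  have hP0 : 0 ≤ C⁻¹ * D + (f a - f x₀) * (1 * (-γ) * (x₀ - a) ^ (-γ - 1)) := by
    by_contra hneg
    push Not at hneg
    have hs : ∀ᶠ y in 𝓝[>] x₀, slope P x₀ y < 0 :=
      (hDP.tendsto_slope.mono_left (nhdsWithin_mono _ (fun x hx => ne_of_gt hx))).eventually_lt_const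
        hneg
    obtain ⟨z, hz, hzs⟩ := (mem_nhdsGT_iff_exists_Ioo_subset).1 hs
    obtain ⟨y, hy, hyb, hr⟩ := hfreq (z - x₀) (sub_pos.2 hz)
    have h1 : slope P x₀ y < 0 := hzs ⟨hy.1, by linarith [hy.2]⟩
    have h2 := hstep y ⟨hy.1, hyb⟩ hr
    rw [slope_def_field] at h1
    have h3 : 0 ≤ (P y - P x₀) / (y - x₀) := div_nonneg (by linarith) (by linarith [hy.1])
    linarith
  have h1 : 0 < (x₀ - a) ^ (-γ - 1) := Real.rpow_pos_of_pos (by linarith) _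
  have h2 : 0 < (f a - f x₀) * (γ * (x₀ - a) ^ (-γ - 1)) :=
    mul_pos (by linarith) (mul_pos hγ0 h1)
  have h3 : 0 < C⁻¹ * D := by nlinarith
  exact (pos_iff_pos_of_mul_pos h3).1 (inv_pos.2 hC)

open MeasureTheory Filter Topology in
lemma time_nonpos {α T t₀ : ℝ} {v : ℝ → ℝ} (hα : 0 < α ∧ α < 1) (ht₀ : t₀ ∈ Ioc 0 T)
    (hvc : ContinuousOn v (Icc 0 T))
    (hv : ∀ t ∈ Ioc 0 T, HasDerivAt v (deriv v t) t)
    (hmin : ∀ t ∈ Icc 0 T, v t₀ ≤ v t) : caputo α 0 v t₀ ≤ 0 := by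
  unfold caputo
  have hΓ := Real.Gamma_pos_of_pos (s := 1 - α) (by linarith [hα.2])
  apply mul_nonpos_of_nonneg_of_nonpos (by positivity)
  by_cases hint : IntervalIntegrable (fun s => (t₀ - s) ^ (-α) * deriv v s) volume 0 t₀
  · have hderiv : deriv (fun s => v s - v t₀) = deriv v := by
      funext s; exact deriv_sub_const _
    have hk := kernel_ibp (G := fun s => v s - v t₀) (e := 0) (y := t₀ + 1) hα.1 hα.2 ht₀.1
      (by linarith) le_rfl zero_le_one
      ((hvc.mono (Icc_subset_Icc_right ht₀.2)).sub continuousOn_const)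
      (fun s hs => by
        rw [hderiv]; exact (hv s ⟨hs.1, hs.2.trans ht₀.2⟩).sub_const _)
      (fun s hs => sub_nonneg.2 (hmin s ⟨hs.1, hs.2.trans ht₀.2⟩)) (sub_self _)
      (by rw [hderiv]; simpa using hint)
    rw [hderiv] at hk
    simp only [zero_mul, sub_zero] at hk
    refine hk.trans (neg_nonpos.2 (mul_nonneg (Real.rpow_nonneg ht₀.1.le _) ?_))
    exact sub_nonneg.2 (hmin 0 ⟨le_rfl, ht₀.1.le.trans ht₀.2⟩)
  · rw [intervalIntegral.integral_undef hint]

/-- minimum principle for the linear time-space fractional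
diffusion equation `𝒟^α_{0+,t} u = ν 𝒟^{β₁}_{a+,x}𝒟^{β₂}_{a+,x} u + F` with
`F ≥ 0`. -/
theorem time_space_diffusion_min_principle
    (α β₁ β₂ ν a b T : ℝ)
    (hα : 0 < α ∧ α < 1) (hβ₁ : 0 < β₁ ∧ β₁ < 1) (hβ₂ : 0 < β₂ ∧ β₂ < 1)
    (hsum : 1 < β₁ + β₂) (hν : 0 < ν) (hab : a < b) (hT : 0 < T)
    (u F : ℝ → ℝ → ℝ) (φ ϕ ψ : ℝ → ℝ)
    -- `u` is continuous on `[a,b] × [0,T]`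
    (hu : ContinuousOn (Function.uncurry u) (Set.Icc a b ×ˢ Set.Icc 0 T))
    -- `x ↦ u(x,t)` is continuously differentiable on `[a,b]`
    (hux : ∀ t ∈ Set.Icc (0:ℝ) T, ∀ x ∈ Set.Icc a b,
      HasDerivAt (fun y => u y t) (deriv (fun y => u y t) x) x)
    (hux' : ∀ t ∈ Set.Icc (0:ℝ) T, ContinuousOn (deriv (fun y => u y t)) (Set.Icc a b))
    -- `t ↦ u(x,t)` is continuously differentiable on `(0,T]`
    (hut : ∀ x ∈ Set.Icc a b, ∀ t ∈ Set.Ioc (0:ℝ) T, HasDerivAt (u x) (deriv (u x) t) t)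
    (hut' : ∀ x ∈ Set.Icc a b, ContinuousOn (deriv (u x)) (Set.Ioc 0 T))
    -- the Caputo time derivative is continuous on `[a,b] × [0,T]`
    (hDt : ContinuousOn (fun p : ℝ × ℝ => caputo α 0 (u p.1) p.2)
      (Set.Icc a b ×ˢ Set.Icc 0 T))
    -- the sequential spatial Caputo derivative exists and is continuous
    (hDxex : ∀ t ∈ Set.Icc (0:ℝ) T, ∀ x ∈ Set.Ioo a b,
      HasDerivAt (seqCaputoAux β₁ β₂ a (fun y => u y t))
        (seqCaputo β₁ β₂ a (fun y => u y t) x) x)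
    (hDx : ContinuousOn (fun p : ℝ × ℝ => seqCaputo β₁ β₂ a (fun y => u y p.2) p.1)
      (Set.Icc a b ×ˢ Set.Icc 0 T))
    -- data
    (hF : ContinuousOn (Function.uncurry F) (Set.Icc a b ×ˢ Set.Icc 0 T))
    (hφ : ContinuousOn φ (Set.Icc a b))
    (hϕ : ContinuousOn ϕ (Set.Icc 0 T)) (hψ : ContinuousOn ψ (Set.Icc 0 T))
    -- the equation on `Ω = (a,b) × (0,T]`
    (heq : ∀ x ∈ Set.Ioo a b, ∀ t ∈ Set.Ioc (0:ℝ) T,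
      caputo α 0 (u x) t = ν * seqCaputo β₁ β₂ a (fun y => u y t) x + F x t)
    -- initial and boundary conditions
    (hinit : ∀ x ∈ Set.Icc a b, u x 0 = φ x)
    (hbd1 : ∀ t ∈ Set.Icc (0:ℝ) T, u a t = ϕ t)
    (hbd2 : ∀ t ∈ Set.Icc (0:ℝ) T, u b t = ψ t)
    (hFpos : ∀ x ∈ Set.Icc a b, ∀ t ∈ Set.Icc (0:ℝ) T, 0 ≤ F x t) :
    ∀ x ∈ Set.Icc a b, ∀ t ∈ Set.Icc (0:ℝ) T,
      min (min (sInf (ϕ '' Set.Icc 0 T)) (sInf (ψ '' Set.Icc 0 T)))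
        (sInf (φ '' Set.Icc a b)) ≤ u x t := by
  intro x hx t ht
  by_contra hcon
  push Not at hcon
  obtain ⟨⟨x₀, t₀⟩, ⟨hx₀, ht₀⟩, hmin⟩ := (isCompact_Icc.prod isCompact_Icc).exists_isMinOn
    ⟨(x, t), ⟨hx, ht⟩⟩ hu
  simp only at hx₀ ht₀
  have hmin' : ∀ x ∈ Icc a b, ∀ t ∈ Icc 0 T, u x₀ t₀ ≤ u x t := fun x hx t ht =>
    hmin (show (x, t) ∈ Icc a b ×ˢ Icc 0 T from ⟨hx, ht⟩)
  have hlt := (hmin' x hx t ht).trans_lt hcon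
  simp only [lt_min_iff] at hlt
  obtain ⟨⟨hl1, hl2⟩, hl3⟩ := hlt
  have b1 : ∀ t ∈ Icc 0 T, u x₀ t₀ < u a t := fun t ht => by
    rw [hbd1 t ht]
    exact hl1.trans_le (csInf_le (isCompact_Icc.image_of_continuousOn hϕ).bddBelow
      (mem_image_of_mem _ ht))
  have b2 : ∀ t ∈ Icc 0 T, u x₀ t₀ < u b t := fun t ht => by
    rw [hbd2 t ht]
    exact hl2.trans_le (csInf_le (isCompact_Icc.image_of_continuousOn hψ).bddBelow
      (mem_image_of_mem _ ht))
  have b3 : ∀ x ∈ Icc a b, u x₀ t₀ < u x 0 := fun x hx => by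
    rw [hinit x hx]
    exact hl3.trans_le (csInf_le (isCompact_Icc.image_of_continuousOn hφ).bddBelow
      (mem_image_of_mem _ hx))
  have hx₁ : x₀ ∈ Ioo a b := by
    refine ⟨lt_of_le_of_ne hx₀.1 ?_, lt_of_le_of_ne hx₀.2 ?_⟩
    · intro h; exact (b1 t₀ ht₀).ne (by rw [h])
    · intro h; exact (b2 t₀ ht₀).ne (by rw [h])
  have ht₁ : t₀ ∈ Ioc 0 T := by
    refine ⟨lt_of_le_of_ne ht₀.1 ?_, ht₀.2⟩
    intro h; exact (b3 x₀ hx₀).ne (by rw [← h])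
  have hS := space_pos (f := fun y => u y t₀) hβ₁ hβ₂ hsum (hux t₀ ht₀) (hux' t₀ ht₀) hx₁
    (fun x hx => hmin' x hx t₀ ht₀) (b1 t₀ ht₀) (hDxex t₀ ht₀ x₀ hx₁)
  have hTm := time_nonpos (v := u x₀) hα ht₁
    (hu.comp (f := fun t => (x₀, t)) (by fun_prop) (fun t ht => ⟨hx₀, ht⟩))
    (hut x₀ hx₀) (fun t ht => hmin' x₀ hx₀ t ht)
  have h1 := heq x₀ hx₁ t₀ ht₁
  have h2 := hFpos x₀ hx₀ t₀ ht₀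
  have h3 := mul_pos hν hS
  linarith
end

section
/- Let 0 < α < 1, 0 < β₁, β₂ < 1 with 1 < β₁ + β₂, ν > 0, −∞ < a < b < +∞, T > 0, and set Ω = (a,b) × (0,T]. Let u : [a,b] × [0,T] → ℝ be continuous such that for each t ∈ [0,T] the map x ↦ u(x,t) is continuously differentiable on [a,b], for each x ∈ [a,b] the map t ↦ u(x,t) is continuously differentiable on (0,T], and the partial fractional derivatives 𝒟^α_{0+,t} u and 𝒟^{β₁}_{a+,x}𝒟^{β₂}_{a+,x} u exist and are continuous on [a,b] × [0,T]. Suppose u satisfies 𝒟^α_{0+,t} u(x,t) = ν · 𝒟^{β₁}_{a+,x}𝒟^{β₂}_{a+,x} u(x,t) + F(x,t) on Ω, u(x,0) = φ(x) for x ∈ [a,b], and u(a,t) = ϕ(t), u(b,t) = ψ(t) for t ∈ [0,T], with F, φ, ϕ, ψ continuous. If F(x,t) ≤ 0 on [a,b] × [0,T], then u(x,t) ≤ max{ sup_{t∈[0,T]} ϕ(t), sup_{t∈[0,T]} ψ(t), sup_{x∈[a,b]} φ(x) } for all (x,t) ∈ [a,b] × [0,T]. -/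
open Set

open MeasureTheory intervalIntegral in
theorem kernel_integrable {p q s y : ℝ} (hp : 0 < p) (hq : 0 < q) (hsy : s < y) :
    IntervalIntegrable (fun x => (y - x) ^ (p - 1) * (x - s) ^ (q - 1)) volume s y := by
  have h1 : IntervalIntegrable (fun x => (y - x) ^ (p - 1) * (x - s) ^ (q - 1)) volume s
      ((s + y) / 2) := by
    have hi : IntervalIntegrable (fun x => (x - s) ^ (q - 1)) volume s ((s + y) / 2) := by
      have := (intervalIntegrable_rpow' (a := 0) (b := (s + y) / 2 - s) (r := q - 1)
        (by linarith)).comp_sub_right s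
      simpa using this
    refine hi.continuousOn_mul ?_
    rw [uIcc_of_le (by linarith)]
    refine ContinuousOn.rpow_const (by fun_prop) ?_
    intro x hx
    left
    have := hx.2
    linarith
  have h2 : IntervalIntegrable (fun x => (y - x) ^ (p - 1) * (x - s) ^ (q - 1)) volume
      ((s + y) / 2) y := by
    have hi : IntervalIntegrable (fun x => (y - x) ^ (p - 1)) volume ((s + y) / 2) y := by
      have := (intervalIntegrable_rpow' (a := y - (s + y) / 2) (b := 0) (r := p - 1)
        (by linarith)).comp_sub_left y
      simpa using this
    refine hi.mul_continuousOn ?_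
    rw [uIcc_of_le (by linarith)]
    refine ContinuousOn.rpow_const (by fun_prop) ?_
    intro x hx
    left
    have := hx.1
    linarith
  exact h1.trans h2

open MeasureTheory intervalIntegral in
theorem kernel_scaled {p q s y : ℝ} (hsy : s < y) :
    ∫ x in s..y, (y - x) ^ (p - 1) * (x - s) ^ (q - 1) =
      (∫ r in (0:ℝ)..1, (1 - r) ^ (p - 1) * (r - 0) ^ (q - 1)) * (y - s) ^ (p + q - 1) := by
  have hL : 0 < y - s := by linarith
  have h := integral_comp_div_sub (a := s) (b := y)
    (fun r : ℝ => (1 - r) ^ (p - 1) * (r - 0) ^ (q - 1)) hL.ne' (s / (y - s))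
  have e1 : s / (y - s) - s / (y - s) = 0 := by ring
  have e2 : y / (y - s) - s / (y - s) = 1 := by field_simp
  rw [e1, e2] at h
  have h3 : ∫ x in s..y, (y - x) ^ (p - 1) * (x - s) ^ (q - 1) =
      ∫ x in s..y, (y - s) ^ (p + q - 2) * ((1 - (x / (y - s) - s / (y - s))) ^ (p - 1) *
        ((x / (y - s) - s / (y - s)) - 0) ^ (q - 1)) := by
    apply integral_congr
    intro x hx
    rw [uIcc_of_le hsy.le] at hx
    have a1 : 1 - (x / (y - s) - s / (y - s)) = (y - x) / (y - s) := by field_simp; ring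
    have a2 : (x / (y - s) - s / (y - s)) - 0 = (x - s) / (y - s) := by field_simp; ring
    simp only [a1, a2]
    rw [Real.div_rpow (by linarith [hx.2]) hL.le, Real.div_rpow (by linarith [hx.1]) hL.le]
    have a3 : (y - s) ^ (p + q - 2) = (y - s) ^ (p - 1) * (y - s) ^ (q - 1) := by
      rw [← Real.rpow_add hL]; congr 1; ring
    have b1 := (Real.rpow_pos_of_pos hL (p - 1)).ne'
    have b2 := (Real.rpow_pos_of_pos hL (q - 1)).ne'
    rw [a3]
    field_simp
  rw [h3, intervalIntegral.integral_const_mul, h, smul_eq_mul]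
  have a4 : (y - s) ^ (p + q - 1) = (y - s) ^ (p + q - 2) * (y - s) := by
    nth_rewrite 3 [← Real.rpow_one (y - s)]
    rw [← Real.rpow_add hL]; congr 1; ring
  rw [a4]
  ring

open MeasureTheory intervalIntegral in
theorem frac_comp {p q : ℝ} (hp : 0 < p) (hq : 0 < q) :
    ∃ B : ℝ, 0 < B ∧ ∀ (c y : ℝ) (g : ℝ → ℝ), c < y → ContinuousOn g (Icc c y) →
      IntervalIntegrable (fun x => (y - x) ^ (p - 1) * ∫ s in c..x, (x - s) ^ (q - 1) * g s)
        volume c y ∧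
      ∫ x in c..y, (y - x) ^ (p - 1) * ∫ s in c..x, (x - s) ^ (q - 1) * g s =
        B * ∫ s in c..y, (y - s) ^ (p + q - 1) * g s := by
  refine ⟨∫ r in (0:ℝ)..1, (1 - r) ^ (p - 1) * (r - 0) ^ (q - 1), ?_, ?_⟩
  · refine intervalIntegral_pos_of_pos_on (kernel_integrable hp hq one_pos) ?_ one_pos
    intro x hx
    have h1 : 0 < 1 - x := by linarith [hx.2]
    have h2 : 0 < x - 0 := by linarith [hx.1]
    positivity
  intro c y g hcy hg
  set B := ∫ r in (0:ℝ)..1, (1 - r) ^ (p - 1) * (r - 0) ^ (q - 1) with hB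
  set μ : Measure ℝ := volume.restrict (Ioc c y) with hμ
  set H : ℝ → ℝ → ℝ := fun x s =>
    (if s < x then (y - x) ^ (p - 1) * (x - s) ^ (q - 1) else 0) * g s with hH
  have hgm : AEStronglyMeasurable g μ :=
    (hg.mono Ioc_subset_Icc_self).aestronglyMeasurable measurableSet_Ioc
  have hmeas : AEStronglyMeasurable (Function.uncurry H) (μ.prod μ) := by
    apply AEStronglyMeasurable.mul
    · apply Measurable.aestronglyMeasurable
      refine Measurable.ite (measurableSet_lt measurable_snd measurable_fst) ?_ measurable_const
      fun_prop
    · exact hgm.comp_snd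
  have hk : ∀ s ∈ Ioc c y, ∀ x ∈ Ioc c y, (if s < x then (y - x) ^ (p - 1) * (x - s) ^ (q - 1) else 0)
      = (Ioc s y).indicator (fun x => (y - x) ^ (p - 1) * (x - s) ^ (q - 1)) x := by
    intro s hs x hx
    by_cases h : s < x
    · simp [h, hx.2]
    · simp [h]
  have hkint : ∀ s ∈ Ioc c y, Integrable
      (fun x => if s < x then (y - x) ^ (p - 1) * (x - s) ^ (q - 1) else 0) μ := by
    intro s hs
    have : Integrable ((Ioc s y).indicator (fun x => (y - x) ^ (p - 1) * (x - s) ^ (q - 1))) μ := by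
      rcases hs.2.eq_or_lt with h | h
      · simp [h]
      rw [integrable_indicator_iff measurableSet_Ioc, hμ]
      have := (intervalIntegrable_iff_integrableOn_Ioc_of_le h.le).1 (kernel_integrable hp hq h)
      exact this.mono_measure Measure.restrict_le_self
    refine this.congr ?_
    filter_upwards [ae_restrict_mem measurableSet_Ioc] with x hx
    exact (hk s hs x hx).symm
  have hkval : ∀ s ∈ Ioo c y, ∫ x, (if s < x then (y - x) ^ (p - 1) * (x - s) ^ (q - 1) else 0) ∂μ
      = B * (y - s) ^ (p + q - 1) := by
    intro s hs
    rw [hB, ← kernel_scaled hs.2, integral_of_le hs.2.le]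
    have : ∫ x, (if s < x then (y - x) ^ (p - 1) * (x - s) ^ (q - 1) else 0) ∂μ =
        ∫ x, (Ioc s y).indicator (fun x => (y - x) ^ (p - 1) * (x - s) ^ (q - 1)) x ∂μ := by
      apply MeasureTheory.integral_congr_ae
      filter_upwards [ae_restrict_mem measurableSet_Ioc] with x hx
      exact hk s (Ioo_subset_Ioc_self hs) x hx
    rw [this, MeasureTheory.integral_indicator measurableSet_Ioc, hμ,
      Measure.restrict_restrict measurableSet_Ioc]
    congr 2
    ext x
    simp only [mem_inter_iff, mem_Ioc]
    constructor
    · exact fun h => h.1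
    · exact fun h => ⟨h, by linarith [hs.1, h.1], h.2⟩
  have hae : ∀ᵐ s ∂μ, s ∈ Ioo c y := by
    rw [hμ, ← restrict_Ioo_eq_restrict_Ioc]
    exact ae_restrict_mem measurableSet_Ioo
  have hout : Integrable (fun s => (y - s) ^ (p + q - 1) * g s) μ := by
    have hi : IntervalIntegrable (fun s => (y - s) ^ (p + q - 1)) volume c y := by
      have := (intervalIntegrable_rpow' (a := y - c) (b := 0) (r := p + q - 1)
        (by linarith)).comp_sub_left y
      simpa using this
    have := hi.mul_continuousOn (g := g) (by rwa [uIcc_of_le hcy.le])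
    exact (intervalIntegrable_iff_integrableOn_Ioc_of_le hcy.le).1 this
  have hIntegrable : Integrable (Function.uncurry H) (μ.prod μ) := by
    rw [integrable_prod_iff' hmeas]
    constructor
    · filter_upwards [hae] with s hs
      exact (hkint s (Ioo_subset_Ioc_self hs)).mul_const (g s)
    · refine (hout.norm.const_mul B).congr ?_
      filter_upwards [hae] with s hs
      have h1 : ∫ x, ‖Function.uncurry H (x, s)‖ ∂μ =
          ∫ x, (if s < x then (y - x) ^ (p - 1) * (x - s) ^ (q - 1) else 0) * ‖g s‖ ∂μ := by
        apply MeasureTheory.integral_congr_ae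
        filter_upwards [ae_restrict_mem measurableSet_Ioc] with x hx
        simp only [hH, Function.uncurry, norm_mul]
        congr 1
        split_ifs with h
        · apply Real.norm_of_nonneg
          have h1 : 0 ≤ y - x := by linarith [hx.2]
          have h2 : 0 ≤ x - s := by linarith
          positivity
        · simp
      have h3 : 0 ≤ y - s := by linarith [hs.2]
      rw [h1, MeasureTheory.integral_mul_const, hkval s hs, norm_mul,
        Real.norm_of_nonneg (Real.rpow_nonneg h3 _)]
      ring
  have hinner : ∀ x ∈ Ioc c y, ∫ s, H x s ∂μ =
      (y - x) ^ (p - 1) * ∫ s in c..x, (x - s) ^ (q - 1) * g s := by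
    intro x hx
    rw [integral_of_le hx.1.le, ← restrict_Ioo_eq_restrict_Ioc, ← MeasureTheory.integral_const_mul]
    have : ∀ s, H x s = (Iio x).indicator
        (fun s => (y - x) ^ (p - 1) * ((x - s) ^ (q - 1) * g s)) s := by
      intro s
      by_cases h : s < x
      · simp [hH, h, mul_assoc]
      · simp [hH, h]
    simp only [this]
    rw [MeasureTheory.integral_indicator measurableSet_Iio, hμ,
      Measure.restrict_restrict measurableSet_Iio]
    congr 2
    ext s
    simp only [mem_inter_iff, mem_Ioc, mem_Ioo, mem_Iio]
    constructor
    · exact fun h => ⟨h.2.1, h.1⟩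
    · exact fun h => ⟨h.2, h.1, by linarith [hx.2, h.2]⟩
  have hinner_ae : (fun x => ∫ s, H x s ∂μ) =ᵐ[μ]
      fun x => (y - x) ^ (p - 1) * ∫ s in c..x, (x - s) ^ (q - 1) * g s := by
    filter_upwards [ae_restrict_mem measurableSet_Ioc] with x hx
    exact hinner x hx
  constructor
  · rw [intervalIntegrable_iff_integrableOn_Ioc_of_le hcy.le]
    exact hIntegrable.integral_prod_left.congr hinner_ae
  · rw [integral_of_le hcy.le, integral_of_le hcy.le, ← MeasureTheory.integral_congr_ae hinner_ae,
      integral_integral_swap hIntegrable, ← MeasureTheory.integral_const_mul]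
    apply MeasureTheory.integral_congr_ae
    filter_upwards [hae] with s hs
    simp only [hH]
    rw [MeasureTheory.integral_mul_const, hkval s hs]
    ring

open MeasureTheory intervalIntegral Filter Topology in
/-- Weighted monotone integration by parts at a left-maximum. -/
theorem left_max_parts {γ p q : ℝ} (hγ : γ < 1) (hpq : p < q) (k k' f : ℝ → ℝ)
    (hkc : ContinuousOn k (Ico p q))
    (hkd : ∀ s ∈ Ioo p q, HasDerivAt k (k' s) s) (hk' : ∀ s ∈ Ioo p q, 0 ≤ k' s)
    (hk0 : ∀ s ∈ Ioo p q, 0 ≤ k s) (hkb : ∀ s ∈ Ioo p q, k s ≤ (q - s) ^ (-γ))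
    (hfc : ContinuousOn f (Icc p q)) (hfd : ∀ s ∈ Ioc p q, HasDerivAt f (deriv f s) s)
    (hmax : ∀ s ∈ Icc p q, f s ≤ f q)
    (hIntegrable : IntervalIntegrable (fun s => k s * deriv f s) volume p q) :
    k p * (f q - f p) ≤ ∫ s in p..q, k s * deriv f s := by
  have hcont : ContinuousOn (fun s => k s * (f s - f q)) (Icc p q) := by
    intro s hs
    rcases hs.2.lt_or_eq with h | h
    · have h1 : ContinuousWithinAt k (Icc p q) s := by
        have := hkc s ⟨hs.1, h⟩
        refine this.mono_of_mem_nhdsWithin ?_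
        have : Icc p q ∩ Iio q ∈ 𝓝[Icc p q] s :=
          inter_mem self_mem_nhdsWithin (mem_nhdsWithin_of_mem_nhds (Iio_mem_nhds h))
        exact mem_of_superset this fun z hz => ⟨hz.1.1, hz.2⟩
      exact h1.mul ((hfc s hs).sub continuousWithinAt_const)
    · subst h
      have hO := (hfd s ⟨hpq, le_rfl⟩).isBigO_sub
      obtain ⟨C, hC⟩ := hO.bound
      have hzero : k s * (f s - f s) = 0 := by ring
      rw [ContinuousWithinAt, hzero]
      have hlim : Tendsto (fun z => |C| * (s - z) ^ (1 - γ)) (𝓝[Icc p s] s) (𝓝 0) := by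
        have : ContinuousAt (fun z => |C| * (s - z) ^ (1 - γ)) s := by
          refine continuousAt_const.mul (ContinuousAt.rpow_const (by fun_prop) (Or.inr ?_))
          linarith
        have h2 := this.tendsto.mono_left (nhdsWithin_le_nhds (s := Icc p s))
        simpa [Real.zero_rpow (by linarith : (1 - γ) ≠ 0)] using h2
      refine squeeze_zero_norm' ?_ hlim
      have hp : ∀ᶠ z in 𝓝[Icc p s] s, p < z :=
        mem_nhdsWithin_of_mem_nhds (Ioi_mem_nhds hpq)
      filter_upwards [mem_nhdsWithin_of_mem_nhds hC, self_mem_nhdsWithin, hp] with z hz hz2 hz3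
      rcases hz2.2.lt_or_eq with h | h
      · have hpos : 0 < s - z := by linarith
        have hz' : ‖f z - f s‖ ≤ C * ‖z - s‖ := hz
        have e : ‖z - s‖ = s - z := by rw [Real.norm_eq_abs, abs_sub_comm, abs_of_pos hpos]
        rw [e] at hz'
        rw [norm_mul, Real.norm_of_nonneg (hk0 z ⟨hz3, h⟩)]
        have e2 : (s - z) ^ (1 - γ) = (s - z) ^ (-γ) * (s - z) := by
          nth_rewrite 3 [← Real.rpow_one (s - z)]
          rw [← Real.rpow_add hpos]; congr 1; ring
        calc k z * ‖f z - f s‖ ≤ (s - z) ^ (-γ) * (|C| * (s - z)) := by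
              apply mul_le_mul (hkb z ⟨hz3, h⟩) _ (norm_nonneg _) (by positivity)
              exact hz'.trans (mul_le_mul_of_nonneg_right (le_abs_self C) hpos.le)
          _ = _ := by rw [e2]; ring
      · subst h
        simp only [sub_self, mul_zero, norm_zero]
        exact mul_nonneg (abs_nonneg _) (Real.rpow_nonneg le_rfl _)
  have := sub_le_integral_of_hasDeriv_right_of_le (g := fun s => k s * (f s - f q))
    (g' := fun s => k' s * (f s - f q) + k s * deriv f s) (φ := fun s => k s * deriv f s)
    hpq.le hcont
    (fun s hs => ((hkd s hs).mul ((hfd s (Ioo_subset_Ioc_self hs)).sub_const (f q))).hasDerivWithinAt)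
    ((intervalIntegrable_iff_integrableOn_Icc_of_le hpq.le).1 hIntegrable)
    (fun s hs => by
      have h1 := hk' s hs
      have h2 := hmax s (Ioo_subset_Icc_self hs)
      nlinarith)
  simp only [sub_self, mul_zero, zero_sub] at this
  linarith

theorem hasDerivAt_kernel {γ x s : ℝ} (h : s < x) :
    HasDerivAt (fun s => (x - s) ^ (-γ)) (γ * (x - s) ^ (-γ - 1)) s := by
  have h0 : 0 < x - s := by linarith
  have := ((hasDerivAt_id s).const_sub x).rpow_const (p := -γ) (Or.inl h0.ne')
  simpa using this

open MeasureTheory intervalIntegral in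
theorem caputo_nonneg {γ t : ℝ} (hγ0 : 0 < γ) (hγ : γ < 1) (ht : 0 < t) (f : ℝ → ℝ)
    (hfc : ContinuousOn f (Icc 0 t)) (hfd : ∀ s ∈ Ioc 0 t, HasDerivAt f (deriv f s) s)
    (hmax : ∀ s ∈ Icc 0 t, f s ≤ f t) : 0 ≤ caputo γ 0 f t := by
  unfold caputo
  apply mul_nonneg
  · have := Real.Gamma_pos_of_pos (s := 1 - γ) (by linarith)
    positivity
  by_cases hIntegrable : IntervalIntegrable (fun s => (t - s) ^ (-γ) * deriv f s) volume 0 t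
  · have := left_max_parts hγ ht (fun s => (t - s) ^ (-γ)) (fun s => γ * (t - s) ^ (-γ - 1)) f
      (fun s hs => (hasDerivAt_kernel hs.2).continuousAt.continuousWithinAt)
      (fun s hs => hasDerivAt_kernel hs.2)
      (fun s hs => mul_nonneg hγ0.le (Real.rpow_nonneg (by linarith [hs.2]) _))
      (fun s hs => Real.rpow_nonneg (by linarith [hs.2]) _) (fun s hs => le_rfl) hfc hfd hmax hIntegrable
    refine le_trans ?_ this
    have h1 := hmax 0 ⟨le_rfl, ht.le⟩
    exact mul_nonneg (Real.rpow_nonneg (by linarith) _) (by linarith)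
  · rw [integral_undef hIntegrable]

open MeasureTheory intervalIntegral in
theorem kernel_mul_integrable {δ c d x : ℝ} (hδ1 : δ < 1) (hcd : c ≤ d) (g : ℝ → ℝ)
    (hg : ContinuousOn g (Icc c d)) :
    IntervalIntegrable (fun s => (x - s) ^ (-δ) * g s) volume c d := by
  have hi : IntervalIntegrable (fun s => (x - s) ^ (-δ)) volume c d := by
    have := (intervalIntegrable_rpow' (a := x - c) (b := x - d) (r := -δ)
      (by linarith)).comp_sub_left x
    simpa using this
  exact hi.mul_continuousOn (by rwa [uIcc_of_le hcd])

open MeasureTheory intervalIntegral in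
theorem history_bound {δ a b x₀ x : ℝ} (hδ0 : 0 < δ) (hδ1 : δ < 1) (hx₀ : a < x₀) (hx : x₀ < x)
    (hxb : x ≤ b) (f : ℝ → ℝ)
    (hfd : ∀ s ∈ Icc a b, HasDerivAt f (deriv f s) s) (hfc : ContinuousOn (deriv f) (Icc a b))
    (hmax : ∀ s ∈ Icc a b, f s ≤ f x₀) :
    (∫ s in a..x₀, (x - s) ^ (-δ) * deriv f s) ≤
      (∫ s in a..x₀, (x₀ - s) ^ (-δ) * deriv f s)
        - δ * (b - a) ^ (-δ - 1) * (f x₀ - f a) * (x - x₀) := by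
  have hsub : Icc a x₀ ⊆ Icc a b := Icc_subset_Icc_right (by linarith)
  have i1 := kernel_mul_integrable (x := x) hδ1 hx₀.le _ (hfc.mono hsub)
  have i2 := kernel_mul_integrable (x := x₀) hδ1 hx₀.le _ (hfc.mono hsub)
  have hIntegrable : IntervalIntegrable
      (fun s => ((x₀ - s) ^ (-δ) - (x - s) ^ (-δ)) * deriv f s) volume a x₀ := by
    simpa only [sub_mul] using i2.sub i1
  have hd : ∀ s, s < x₀ → HasDerivAt (fun s => (x₀ - s) ^ (-δ) - (x - s) ^ (-δ))
      (δ * (x₀ - s) ^ (-δ - 1) - δ * (x - s) ^ (-δ - 1)) s := fun s hs =>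
    (hasDerivAt_kernel hs).sub (hasDerivAt_kernel (by linarith))
  have key := left_max_parts hδ1 hx₀ (fun s => (x₀ - s) ^ (-δ) - (x - s) ^ (-δ))
    (fun s => δ * (x₀ - s) ^ (-δ - 1) - δ * (x - s) ^ (-δ - 1)) f
    (fun s hs => (hd s hs.2).continuousAt.continuousWithinAt)
    (fun s hs => hd s hs.2)
    (fun s hs => by
      have := Real.rpow_le_rpow_of_nonpos (x := x₀ - s) (y := x - s) (z := -δ - 1)
        (by linarith [hs.2]) (by linarith) (by linarith)
      have := mul_le_mul_of_nonneg_left this hδ0.le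
      linarith)
    (fun s hs => by
      have := Real.rpow_le_rpow_of_nonpos (x := x₀ - s) (y := x - s) (z := -δ)
        (by linarith [hs.2]) (by linarith) (by linarith)
      linarith)
    (fun s hs => by
      have := Real.rpow_nonneg (x := x - s) (by linarith [hs.2]) (-δ)
      linarith)
    (fun s hs => (hfd s (hsub hs)).continuousAt.continuousWithinAt)
    (fun s hs => hfd s (hsub (Ioc_subset_Icc_self hs)))
    (fun s hs => hmax s (hsub hs)) hIntegrable
  simp only [sub_mul] at key
  rw [intervalIntegral.integral_sub i2 i1] at key
  -- mean value bound
  have hmv : δ * (b - a) ^ (-δ - 1) * (x - x₀) ≤ (x₀ - a) ^ (-δ) - (x - a) ^ (-δ) := by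
    have hdz : ∀ z ∈ Ioo x₀ x, HasDerivAt (fun z => (z - a) ^ (-δ)) (-δ * (z - a) ^ (-δ - 1)) z := by
      intro z hz
      have := ((hasDerivAt_id z).sub_const a).rpow_const (p := -δ)
        (Or.inl (by simp only [id]; linarith [hz.1]))
      simpa using this
    obtain ⟨z, hz, hz'⟩ := exists_hasDerivAt_eq_slope (fun z => (z - a) ^ (-δ))
      (fun z => -δ * (z - a) ^ (-δ - 1)) hx
      (ContinuousOn.rpow_const (by fun_prop) (fun z hz => Or.inl (by linarith [hz.1]))) hdz
    have hpos : 0 < x - x₀ := by linarith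
    rw [eq_div_iff hpos.ne'] at hz'
    have := Real.rpow_le_rpow_of_nonpos (x := z - a) (y := b - a) (z := -δ - 1)
      (by linarith [hz.1]) (by linarith [hz.2]) (by linarith)
    have := mul_le_mul_of_nonneg_right (mul_le_mul_of_nonneg_left this hδ0.le) hpos.le
    linarith
  have h0 : 0 ≤ f x₀ - f a := by linarith [hmax a ⟨le_rfl, by linarith⟩]
  have := mul_le_mul_of_nonneg_right hmv h0
  nlinarith

open MeasureTheory intervalIntegral in
theorem future_bound {δ x₀ y : ℝ} (hδ1 : δ < 1) (hx : x₀ < y) (f : ℝ → ℝ)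
    (hfd : ∀ s ∈ Icc x₀ y, HasDerivAt f (deriv f s) s) (hfc : ContinuousOn (deriv f) (Icc x₀ y))
    (hmax : ∀ s ∈ Icc x₀ y, f s ≤ f x₀) :
    ∫ s in x₀..y, (y - s) ^ (1 - δ) * deriv f s ≤ 0 := by
  have hkc : Continuous (fun s : ℝ => (y - s) ^ (1 - δ)) :=
    Continuous.rpow_const (by fun_prop) (fun _ => Or.inr (by linarith))
  have := integral_le_sub_of_hasDeriv_right_of_le (g := fun s => (y - s) ^ (1 - δ) * (f s - f x₀))
    (g' := fun s => ((δ - 1) * (y - s) ^ (-δ)) * (f s - f x₀) + (y - s) ^ (1 - δ) * deriv f s)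
    (φ := fun s => (y - s) ^ (1 - δ) * deriv f s) hx.le
    (hkc.continuousOn.mul (fun s hs =>
      ((hfd s hs).continuousAt.sub continuousAt_const).continuousWithinAt))
    (fun s hs => by
      have h1 := hasDerivAt_kernel (γ := δ - 1) hs.2
      have e1 : -(δ - 1) = 1 - δ := by ring
      have e2 : 1 - δ - 1 = -δ := by ring
      rw [e1, e2] at h1
      exact (h1.mul ((hfd s (Ioo_subset_Icc_self hs)).sub_const (f x₀))).hasDerivWithinAt)
    ((hkc.continuousOn.mul hfc).integrableOn_Icc)
    (fun s hs => by
      have h1 := hmax s (Ioo_subset_Icc_self hs)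
      have h2 := Real.rpow_nonneg (x := y - s) (by linarith [hs.2]) (-δ)
      have : 0 ≤ ((1 - δ) * (y - s) ^ (-δ)) * (f x₀ - f s) :=
        mul_nonneg (mul_nonneg (by linarith) h2) (by linarith)
      nlinarith)
  simpa [Real.zero_rpow (by linarith : 1 - δ ≠ 0)] using this

open MeasureTheory intervalIntegral Filter Topology in
theorem seq_deriv_neg {β₁ β₂ a b x₀ D : ℝ} (hβ₁ : β₁ < 1) (hβ₂ : β₂ < 1)
    (hsum : 1 < β₁ + β₂) (hx₀ : x₀ ∈ Ioo a b) (f : ℝ → ℝ)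
    (hfd : ∀ s ∈ Icc a b, HasDerivAt f (deriv f s) s) (hfc : ContinuousOn (deriv f) (Icc a b))
    (hmax : ∀ s ∈ Icc a b, f s ≤ f x₀) (hlt : f a < f x₀)
    (hD : HasDerivAt (seqCaputoAux β₁ β₂ a f) D x₀) : D < 0 := by
  obtain ⟨δ, hδ⟩ : ∃ δ, δ = β₁ + β₂ - 1 := ⟨_, rfl⟩
  have hδ0 : 0 < δ := by linarith
  have hδ1 : δ < 1 := by linarith
  obtain ⟨B, hB, hBf⟩ := frac_comp (p := 1 - β₁) (q := 1 - β₂) (by linarith) (by linarith)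
  have hG1 := Real.Gamma_pos_of_pos (s := 1 - β₁) (by linarith)
  have hG2 := Real.Gamma_pos_of_pos (s := 1 - β₂) (by linarith)
  obtain ⟨C, hC⟩ : ∃ C, C = 1 / Real.Gamma (1 - β₁) * (1 / Real.Gamma (1 - β₂)) * B := ⟨_, rfl⟩
  have hCpos : 0 < C := by rw [hC]; positivity
  have hJ : ∀ x ∈ Ioc a b, seqCaputoAux β₁ β₂ a f x
      = C * ∫ s in a..x, (x - s) ^ (-δ) * deriv f s := by
    intro x hx
    have h := (hBf a x (deriv f) hx.1 (hfc.mono (Icc_subset_Icc_right hx.2))).2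
    have e1 : 1 - β₁ - 1 = -β₁ := by ring
    have e2 : 1 - β₂ - 1 = -β₂ := by ring
    have e3 : 1 - β₁ + (1 - β₂) - 1 = -δ := by rw [hδ]; ring
    rw [e1, e2, e3] at h
    unfold seqCaputoAux caputo
    have h2 : ∀ s, (x - s) ^ (-β₁) * (1 / Real.Gamma (1 - β₂) *
        ∫ r in a..s, (s - r) ^ (-β₂) * deriv f r) = 1 / Real.Gamma (1 - β₂) *
        ((x - s) ^ (-β₁) * ∫ r in a..s, (s - r) ^ (-β₂) * deriv f r) := by intro s; ring
    simp only [h2]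
    rw [intervalIntegral.integral_const_mul, h, hC]
    ring
  by_contra hneg
  push Not at hneg
  obtain ⟨c, hc⟩ : ∃ c, c = δ * (b - a) ^ (-δ - 1) * (f x₀ - f a) := ⟨_, rfl⟩
  have hba : 0 < b - a := by linarith [hx₀.1, hx₀.2]
  have hfp : 0 < f x₀ - f a := by linarith
  have hcpos : 0 < c := by rw [hc]; positivity
  have hev := (hasDerivAt_iff_isLittleO.1 hD).bound (show 0 < C * (c / 2) by positivity)
  obtain ⟨r, hr, hball⟩ := Metric.eventually_nhds_iff.1 hev
  obtain ⟨y, hy0, hyb, hyr⟩ : ∃ y, x₀ < y ∧ y ≤ b ∧ y < x₀ + r := by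
    refine ⟨min b (x₀ + r / 2), lt_min hx₀.2 (by linarith), min_le_left _ _, ?_⟩
    exact (min_le_right _ _).trans_lt (by linarith)
  have hS : ∀ x ∈ Ioo x₀ y, 0 < ∫ s in x₀..x, (x - s) ^ (-δ) * deriv f s := by
    intro x hx
    have hpos : 0 < x - x₀ := by linarith [hx.1]
    have h1 := hball (y := x) (by
      rw [Real.dist_eq, abs_of_pos hpos]; linarith [hx.2])
    rw [Real.norm_eq_abs, Real.norm_eq_abs, abs_of_pos hpos, smul_eq_mul] at h1
    have h2 := (abs_le.1 h1).1
    rw [hJ x ⟨by linarith [hx₀.1], by linarith [hx.2]⟩, hJ x₀ ⟨hx₀.1, hx₀.2.le⟩] at h2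
    have h3 := history_bound hδ0 hδ1 hx₀.1 hx.1 (by linarith [hx.2]) f hfd hfc hmax
    rw [← hc] at h3
    have h4 := integral_add_adjacent_intervals
      (kernel_mul_integrable (x := x) hδ1 hx₀.1.le (deriv f)
        (hfc.mono (Icc_subset_Icc_right hx₀.2.le)))
      (kernel_mul_integrable (x := x) hδ1 hx.1.le (deriv f)
        (hfc.mono (Icc_subset_Icc hx₀.1.le (by linarith [hx.2]))))
    have h5 : 0 ≤ (x - x₀) * D := mul_nonneg hpos.le hneg
    have h6 : C * ((∫ s in a..x₀, (x₀ - s) ^ (-δ) * deriv f s) - c / 2 * (x - x₀)) ≤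
        C * ∫ s in a..x, (x - s) ^ (-δ) * deriv f s := by linarith
    have h7 := le_of_mul_le_mul_left h6 hCpos
    have h8 : 0 < c / 2 * (x - x₀) := by positivity
    linarith
  obtain ⟨B', hB', hBf'⟩ := frac_comp (p := 1) (q := 1 - δ) one_pos (by linarith)
  have hsub : Icc x₀ y ⊆ Icc a b := Icc_subset_Icc hx₀.1.le hyb
  obtain ⟨hi, hv⟩ := hBf' x₀ y (deriv f) hy0 (hfc.mono hsub)
  have e1 : (1 : ℝ) - 1 = 0 := by ring
  have e2 : 1 - δ - 1 = -δ := by ring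
  have e3 : 1 + (1 - δ) - 1 = 1 - δ := by ring
  simp only [e1, e2, e3, Real.rpow_zero, one_mul] at hi hv
  have hp := intervalIntegral_pos_of_pos_on hi hS hy0
  have hn := future_bound hδ1 hy0 f (fun s hs => hfd s (hsub hs)) (hfc.mono hsub)
    (fun s hs => hmax s (hsub hs))
  rw [hv] at hp
  nlinarith

/-- maximum principle for the linear time-space fractional
diffusion equation `𝒟^α_{0+,t} u = ν 𝒟^{β₁}_{a+,x}𝒟^{β₂}_{a+,x} u + F` with
`F ≤ 0`. -/
theorem time_space_diffusion_max_principle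
    (α β₁ β₂ ν a b T : ℝ)
    (hα : 0 < α ∧ α < 1) (hβ₁ : 0 < β₁ ∧ β₁ < 1) (hβ₂ : 0 < β₂ ∧ β₂ < 1)
    (hsum : 1 < β₁ + β₂) (hν : 0 < ν) (hab : a < b) (hT : 0 < T)
    (u F : ℝ → ℝ → ℝ) (φ ϕ ψ : ℝ → ℝ)
    (hu : ContinuousOn (Function.uncurry u) (Set.Icc a b ×ˢ Set.Icc 0 T))
    (hux : ∀ t ∈ Set.Icc (0:ℝ) T, ∀ x ∈ Set.Icc a b,
      HasDerivAt (fun y => u y t) (deriv (fun y => u y t) x) x)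
    (hux' : ∀ t ∈ Set.Icc (0:ℝ) T, ContinuousOn (deriv (fun y => u y t)) (Set.Icc a b))
    (hut : ∀ x ∈ Set.Icc a b, ∀ t ∈ Set.Ioc (0:ℝ) T, HasDerivAt (u x) (deriv (u x) t) t)
    (hut' : ∀ x ∈ Set.Icc a b, ContinuousOn (deriv (u x)) (Set.Ioc 0 T))
    (hDt : ContinuousOn (fun p : ℝ × ℝ => caputo α 0 (u p.1) p.2)
      (Set.Icc a b ×ˢ Set.Icc 0 T))
    (hDxex : ∀ t ∈ Set.Icc (0:ℝ) T, ∀ x ∈ Set.Ioo a b,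
      HasDerivAt (seqCaputoAux β₁ β₂ a (fun y => u y t))
        (seqCaputo β₁ β₂ a (fun y => u y t) x) x)
    (hDx : ContinuousOn (fun p : ℝ × ℝ => seqCaputo β₁ β₂ a (fun y => u y p.2) p.1)
      (Set.Icc a b ×ˢ Set.Icc 0 T))
    (hF : ContinuousOn (Function.uncurry F) (Set.Icc a b ×ˢ Set.Icc 0 T))
    (hφ : ContinuousOn φ (Set.Icc a b))
    (hϕ : ContinuousOn ϕ (Set.Icc 0 T)) (hψ : ContinuousOn ψ (Set.Icc 0 T))
    (heq : ∀ x ∈ Set.Ioo a b, ∀ t ∈ Set.Ioc (0:ℝ) T,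
      caputo α 0 (u x) t = ν * seqCaputo β₁ β₂ a (fun y => u y t) x + F x t)
    (hinit : ∀ x ∈ Set.Icc a b, u x 0 = φ x)
    (hbd1 : ∀ t ∈ Set.Icc (0:ℝ) T, u a t = ϕ t)
    (hbd2 : ∀ t ∈ Set.Icc (0:ℝ) T, u b t = ψ t)
    (hFneg : ∀ x ∈ Set.Icc a b, ∀ t ∈ Set.Icc (0:ℝ) T, F x t ≤ 0) :
    ∀ x ∈ Set.Icc a b, ∀ t ∈ Set.Icc (0:ℝ) T,
      u x t ≤ max (max (sSup (ϕ '' Set.Icc 0 T)) (sSup (ψ '' Set.Icc 0 T)))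
        (sSup (φ '' Set.Icc a b)) := by
  intro x hx t ht
  by_contra hcon
  push Not at hcon
  have hcomp : IsCompact (Set.Icc a b ×ˢ Set.Icc (0:ℝ) T) := isCompact_Icc.prod isCompact_Icc
  obtain ⟨⟨x₀, t₀⟩, ⟨hx₀, ht₀⟩, hmax⟩ := hcomp.exists_isMaxOn ⟨(x, t), hx, ht⟩ hu
  have hmax' : ∀ y ∈ Set.Icc a b, ∀ s ∈ Set.Icc (0:ℝ) T, u y s ≤ u x₀ t₀ :=
    fun y hy s hs => hmax (show (y, s) ∈ Set.Icc a b ×ˢ Set.Icc (0:ℝ) T from ⟨hy, hs⟩)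
  simp only at hx₀ ht₀
  have hbig := lt_of_lt_of_le hcon (hmax' x hx t ht)
  have h12 := (max_lt_iff.1 hbig).1
  have h3 := (max_lt_iff.1 hbig).2
  have h1 := (max_lt_iff.1 h12).1
  have h2 := (max_lt_iff.1 h12).2
  have b1 : ∀ s ∈ Set.Icc (0:ℝ) T, u a s < u x₀ t₀ := fun s hs => by
    rw [hbd1 s hs]
    exact (le_csSup (isCompact_Icc.image_of_continuousOn hϕ).bddAbove
      (Set.mem_image_of_mem _ hs)).trans_lt h1
  have b2 : ∀ s ∈ Set.Icc (0:ℝ) T, u b s < u x₀ t₀ := fun s hs => by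
    rw [hbd2 s hs]
    exact (le_csSup (isCompact_Icc.image_of_continuousOn hψ).bddAbove
      (Set.mem_image_of_mem _ hs)).trans_lt h2
  have b3 : ∀ y ∈ Set.Icc a b, u y 0 < u x₀ t₀ := fun y hy => by
    rw [hinit y hy]
    exact (le_csSup (isCompact_Icc.image_of_continuousOn hφ).bddAbove
      (Set.mem_image_of_mem _ hy)).trans_lt h3
  have hxa : a < x₀ := lt_of_le_of_ne hx₀.1 fun h => by
    subst h; exact lt_irrefl _ (b1 t₀ ht₀)
  have hxb : x₀ < b := lt_of_le_of_ne hx₀.2 fun h => by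
    subst h; exact lt_irrefl _ (b2 t₀ ht₀)
  have ht0 : 0 < t₀ := lt_of_le_of_ne ht₀.1 fun h => by
    subst h; exact lt_irrefl _ (b3 x₀ hx₀)
  have hneg := seq_deriv_neg hβ₁.2 hβ₂.2 hsum ⟨hxa, hxb⟩ (fun y => u y t₀) (hux t₀ ht₀)
    (hux' t₀ ht₀) (fun y hy => hmax' y hy t₀ ht₀) (b1 t₀ ht₀) (hDxex t₀ ht₀ x₀ ⟨hxa, hxb⟩)
  have hcont : ContinuousOn (u x₀) (Set.Icc 0 t₀) := by
    have hc : ContinuousOn (fun s : ℝ => (x₀, s)) (Set.Icc 0 t₀) := by fun_prop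
    exact hu.comp hc fun s hs => ⟨hx₀, hs.1, hs.2.trans ht₀.2⟩
  have hpos := caputo_nonneg hα.1 hα.2 ht0 (u x₀) hcont
    (fun s hs => hut x₀ hx₀ s ⟨hs.1, hs.2.trans ht₀.2⟩)
    (fun s hs => hmax' x₀ hx₀ s ⟨hs.1, hs.2.trans ht₀.2⟩)
  have he := heq x₀ ⟨hxa, hxb⟩ t₀ ⟨ht0, ht₀.2⟩
  have hf := hFneg x₀ hx₀ t₀ ht₀
  have := mul_neg_of_pos_of_neg hν hneg
  linarith
end
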